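/- arXiv:2106.08635 — 8 statements merged into one kernel-verified Lean document; each statement's English description precedes it below -/
import Mathlib

section
/- Let h(x,w) be a smooth real-valued function on a neighbourhood of 0 ∈ ℝ²×ℝ, and let primes denote derivatives with respect to w. Then [h''(0) ≠ 0 and 9h⁽⁵⁾(h'')² − 45h⁽⁴⁾h⁽³⁾h'' + 40(h⁽³⁾)³ = 0 on a neighbourhood of 0] holds if and only if there exist smooth functions a, d, e of x ∈ ℝ² near 0 with a(0) ≠ 0 such that h''(x,w) = a(x)·(d(x)w² + e(x)w + 1)^{−3/2} on a neighbourhood of 0. -/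
noncomputable section

open Set

lemma aux_const (f : ℝ → ℝ) (r : ℝ) (hf : ∀ w ∈ Set.Ioo (-r) r, HasDerivAt f 0 w) :
    ∀ w ∈ Set.Ioo (-r) r, f w = f 0 := by
  intro w hw
  have h0 : (0:ℝ) ∈ Set.Ioo (-r) r := by
    have h1 := hw.1
    have h2 := hw.2
    constructor <;> linarith
  exact isOpen_Ioo.is_const_of_deriv_eq_zero isPreconnected_Ioo
    (fun x hx => (hf x hx).differentiableAt.differentiableWithinAt)
    (fun x hx => (hf x hx).deriv) hw h0

lemma aux_forward (v v1 v2 v3 : ℝ → ℝ) (r : ℝ)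
    (h1 : ∀ w ∈ Set.Ioo (-r) r, HasDerivAt v (v1 w) w)
    (h2 : ∀ w ∈ Set.Ioo (-r) r, HasDerivAt v1 (v2 w) w)
    (h3 : ∀ w ∈ Set.Ioo (-r) r, HasDerivAt v2 (v3 w) w)
    (hpos : ∀ w ∈ Set.Ioo (-r) r, 0 < v w) (hv0 : v 0 = 1)
    (hode : ∀ w ∈ Set.Ioo (-r) r,
      9 * v3 w * v w ^ 2 - 45 * v2 w * v1 w * v w + 40 * v1 w ^ 3 = 0) :
    ∀ w ∈ Set.Ioo (-r) r,
      0 < (5/9 * v1 0 ^ 2 - 1/3 * v2 0) * w ^ 2 + (-(2/3) * v1 0) * w + 1 ∧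
      v w = ((5/9 * v1 0 ^ 2 - 1/3 * v2 0) * w ^ 2 + (-(2/3) * v1 0) * w + 1) ^ (-(3/2) : ℝ) := by
  set y : ℝ → ℝ := fun w => v w ^ (-(2/3) : ℝ) with hy
  set y1 : ℝ → ℝ := fun w => -(2/3) * (v w ^ (-(5/3) : ℝ) * v1 w) with hy1
  set y2 : ℝ → ℝ := fun w => 10/9 * (v w ^ (-(8/3) : ℝ) * v1 w ^ 2)
    - 2/3 * (v w ^ (-(5/3) : ℝ) * v2 w) with hy2
  have pw : ∀ w ∈ Set.Ioo (-r) r, ∀ q : ℝ,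
      HasDerivAt (fun w => v w ^ q) (v1 w * q * v w ^ (q - 1)) w := fun w hw q =>
    (h1 w hw).rpow_const (Or.inl (hpos w hw).ne')
  have d1 : ∀ w ∈ Set.Ioo (-r) r, HasDerivAt y (y1 w) w := by
    intro w hw
    refine (pw w hw _).congr_deriv ?_
    rw [show (-(2/3) - 1 : ℝ) = -(5/3) by norm_num, hy1]
    ring
  have d2 : ∀ w ∈ Set.Ioo (-r) r, HasDerivAt y1 (y2 w) w := by
    intro w hw
    refine (((pw w hw (-(5/3))).mul (h2 w hw)).const_mul (-(2/3))).congr_deriv ?_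
    rw [show (-(5/3) - 1 : ℝ) = -(8/3) by norm_num, hy2]
    ring
  have d3 : ∀ w ∈ Set.Ioo (-r) r, HasDerivAt y2 0 w := by
    intro w hw
    refine ((((pw w hw (-(8/3))).mul ((h2 w hw).pow 2)).const_mul (10/9)).sub
      (((pw w hw (-(5/3))).mul (h3 w hw)).const_mul (2/3))).congr_deriv ?_
    rw [show (-(8/3) - 1 : ℝ) = -(11/3) by norm_num, show (-(5/3) - 1 : ℝ) = -(8/3) by norm_num]
    have e1 : v w ^ (-(8/3) : ℝ) = v w ^ (-(11/3) : ℝ) * v w := by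
      rw [← Real.rpow_add_one (hpos w hw).ne']; norm_num
    have e2 : v w ^ (-(5/3) : ℝ) = v w ^ (-(11/3) : ℝ) * v w ^ 2 := by
      rw [← Real.rpow_add_natCast (hpos w hw).ne']; norm_num
    rw [e1, e2]
    simp only [Pi.pow_apply]
    linear_combination (-(2/27)) * v w ^ (-(11/3) : ℝ) * hode w hw
  intro w hw
  have c2 := aux_const y2 r d3
  have c1 := aux_const (fun w => y1 w - y2 0 * w) r (fun w hw =>
    ((d2 w hw).sub ((hasDerivAt_id w).const_mul (y2 0))).congr_deriv (by
      rw [c2 w hw]; ring))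
  have c0 := aux_const (fun w => y w - (y2 0 / 2 * w ^ 2 + y1 0 * w)) r (fun w hw =>
    ((d1 w hw).sub ((((hasDerivAt_id w).pow 2).const_mul (y2 0 / 2)).add
      ((hasDerivAt_id w).const_mul (y1 0)))).congr_deriv (by
        have := c1 w hw
        simp at this ⊢
        linarith))
  have key := c0 w hw
  have q0 : y 0 = 1 := by simp [hy, hv0]
  have q1 : y1 0 = -(2/3) * v1 0 := by simp [hy1, hv0]
  have q2 : y2 0 = 10/9 * v1 0 ^ 2 - 2/3 * v2 0 := by simp [hy2, hv0]
  have E : (5/9 * v1 0 ^ 2 - 1/3 * v2 0) * w ^ 2 + (-(2/3) * v1 0) * w + 1 = y w := by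
    simp only [q0, q1, q2] at key
    linear_combination -key
  rw [E]
  refine ⟨Real.rpow_pos_of_pos (hpos w hw) _, ?_⟩
  rw [hy]
  simp only
  rw [← Real.rpow_mul (hpos w hw).le]
  norm_num

lemma aux_backward (u : ℝ → ℝ) (S : Set ℝ) (hS : IsOpen S) (a d e : ℝ)
    (hy : ∀ w ∈ S, 0 < d * w ^ 2 + e * w + 1)
    (hu : ∀ w ∈ S, u w = a * (d * w ^ 2 + e * w + 1) ^ (-(3/2) : ℝ)) :
    ∀ w ∈ S, 9 * deriv (deriv (deriv u)) w * u w ^ 2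
      - 45 * deriv (deriv u) w * deriv u w * u w + 40 * deriv u w ^ 3 = 0 := by
  set y : ℝ → ℝ := fun w => d * w ^ 2 + e * w + 1 with hyd
  set y1 : ℝ → ℝ := fun w => 2 * d * w + e with hy1
  have dy : ∀ w, HasDerivAt y (y1 w) w := fun w =>
    ((((hasDerivAt_id w).pow 2).const_mul d).add ((hasDerivAt_id w).const_mul e)
      |>.add_const 1).congr_deriv (by simp [hy1]; ring)
  have dy1 : ∀ w, HasDerivAt y1 (2 * d) w := fun w =>
    (((hasDerivAt_id w).const_mul (2 * d)).add_const e).congr_deriv (by simp)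
  have pw : ∀ w ∈ S, ∀ q : ℝ,
      HasDerivAt (fun w => y w ^ q) (y1 w * q * y w ^ (q - 1)) w := fun w hw q =>
    (dy w).rpow_const (Or.inl (hy w hw).ne')
  have step : ∀ f g g' : ℝ → ℝ, (∀ w ∈ S, f w = g w) → (∀ w ∈ S, HasDerivAt g (g' w) w) →
      ∀ w ∈ S, deriv f w = g' w := by
    intro f g g' hfg hg w hw
    have : f =ᶠ[nhds w] g := Filter.eventually_of_mem (hS.mem_nhds hw) hfg
    rw [this.deriv_eq]
    exact (hg w hw).deriv
  have E1 := step u _ (fun w => a * (-(3/2)) * (y w ^ (-(5/2) : ℝ) * y1 w)) hu (fun w hw =>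
    ((pw w hw (-(3/2))).const_mul a).congr_deriv (by
      rw [show (-(3/2) - 1 : ℝ) = -(5/2) by norm_num]; ring))
  have E2 := step (deriv u) _ (fun w => a * (15/4 * (y w ^ (-(7/2) : ℝ) * y1 w ^ 2)
      - 3 * d * y w ^ (-(5/2) : ℝ))) E1 (fun w hw =>
    (((pw w hw (-(5/2))).mul (dy1 w)).const_mul (a * (-(3/2)))).congr_deriv (by
      rw [show (-(5/2) - 1 : ℝ) = -(7/2) by norm_num]; ring))
  have E3 := step (deriv (deriv u)) _ (fun w => a * (-(105/8) * (y w ^ (-(9/2) : ℝ) * y1 w ^ 3)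
      + 45/2 * d * (y w ^ (-(7/2) : ℝ) * y1 w))) E2 (fun w hw =>
    (((((pw w hw (-(7/2))).mul ((dy1 w).pow 2)).const_mul (15/4)).sub
      ((pw w hw (-(5/2))).const_mul (3 * d))).const_mul a).congr_deriv (by
      rw [show (-(7/2) - 1 : ℝ) = -(9/2) by norm_num, show (-(5/2) - 1 : ℝ) = -(7/2) by norm_num]
      simp only [Pi.pow_apply]
      ring))
  intro w hw
  have hyw : y w ≠ 0 := (hy w hw).ne'
  have e1 : y w ^ (-(7/2) : ℝ) = y w ^ (-(9/2) : ℝ) * y w := by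
    rw [← Real.rpow_add_one hyw]; norm_num
  have e2 : y w ^ (-(5/2) : ℝ) = y w ^ (-(9/2) : ℝ) * y w ^ 2 := by
    rw [← Real.rpow_add_natCast hyw]; norm_num
  have e3 : y w ^ (-(3/2) : ℝ) = y w ^ (-(9/2) : ℝ) * y w ^ 3 := by
    rw [← Real.rpow_add_natCast hyw]; norm_num
  have E0 : u w = a * y w ^ (-(3/2) : ℝ) := hu w hw
  rw [E3 w hw, E2 w hw, E1 w hw, E0]
  simp only [e1, e2, e3]
  ring

lemma aux_smooth (f : (ℝ × ℝ) → ℝ → ℝ) (V : Set ((ℝ × ℝ) × ℝ)) (hV : IsOpen V)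
    (hf : ContDiffOn ℝ (⊤ : ℕ∞) (fun p : (ℝ × ℝ) × ℝ => f p.1 p.2) V) :
    ContDiffOn ℝ (⊤ : ℕ∞) (fun p : (ℝ × ℝ) × ℝ => deriv (f p.1) p.2) V ∧
    ∀ p ∈ V, HasDerivAt (f p.1) (deriv (f p.1) p.2) p.2 := by
  have key : ∀ p ∈ V, HasDerivAt (f p.1)
      (fderiv ℝ (fun p : (ℝ × ℝ) × ℝ => f p.1 p.2) p ((0 : ℝ × ℝ), (1 : ℝ))) p.2 := by
    intro p hp
    have hd : HasFDerivAt (fun p : (ℝ × ℝ) × ℝ => f p.1 p.2) _ (p.1, p.2) :=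
      ((hf.contDiffAt (hV.mem_nhds hp)).differentiableAt (by simp)).hasFDerivAt
    exact hd.comp_hasDerivAt p.2 ((hasDerivAt_const p.2 p.1).prodMk (hasDerivAt_id p.2))
  constructor
  · have := (hf.fderiv_of_isOpen (m := (⊤ : ℕ∞)) hV (by simp)).clm_apply
      (contDiffOn_const (c := ((0 : ℝ × ℝ), (1 : ℝ))))
    exact this.congr (fun p hp => (key p hp).deriv)
  · intro p hp
    exact (key p hp).differentiableAt.hasDerivAt

/-- for `h(x,w)` smooth near `0 ∈ ℝ²×ℝ` (primes denoting `∂/∂w`):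
`h''(0) ≠ 0` and `9h⁽⁵⁾(h'')² − 45h⁽⁴⁾h⁽³⁾h'' + 40(h⁽³⁾)³ = 0` near `0` hold iff there are
smooth `a, d, e` of `x` with `a(0) ≠ 0` such that `h'' = a(x)·(d(x)w² + e(x)w + 1)^(−3/2)`
near `0` (with positive base). -/
theorem stmt_7 (h : (ℝ × ℝ) → ℝ → ℝ) (V : Set ((ℝ × ℝ) × ℝ))
    (hV : IsOpen V) (h0V : (0 : (ℝ × ℝ) × ℝ) ∈ V)
    (hh : ContDiffOn ℝ (⊤ : ℕ∞) (fun p : (ℝ × ℝ) × ℝ => h p.1 p.2) V) :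
    (deriv (deriv (h 0)) 0 ≠ 0 ∧
      ∃ W : Set ((ℝ × ℝ) × ℝ), IsOpen W ∧ (0 : (ℝ × ℝ) × ℝ) ∈ W ∧ W ⊆ V ∧
        ∀ p ∈ W,
          9 * deriv (deriv (deriv (deriv (deriv (h p.1))))) p.2
              * (deriv (deriv (h p.1)) p.2) ^ 2
            - 45 * deriv (deriv (deriv (deriv (h p.1)))) p.2
              * deriv (deriv (deriv (h p.1))) p.2 * deriv (deriv (h p.1)) p.2
            + 40 * (deriv (deriv (deriv (h p.1))) p.2) ^ 3 = 0)
    ↔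
    (∃ (a d e : (ℝ × ℝ) → ℝ) (U2 : Set (ℝ × ℝ)),
      IsOpen U2 ∧ (0 : ℝ × ℝ) ∈ U2 ∧
      ContDiffOn ℝ (⊤ : ℕ∞) a U2 ∧ ContDiffOn ℝ (⊤ : ℕ∞) d U2 ∧ ContDiffOn ℝ (⊤ : ℕ∞) e U2 ∧
      a 0 ≠ 0 ∧
      ∃ W : Set ((ℝ × ℝ) × ℝ), IsOpen W ∧ (0 : (ℝ × ℝ) × ℝ) ∈ W ∧ W ⊆ V ∧
        ∀ p ∈ W, p.1 ∈ U2 ∧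
          0 < d p.1 * p.2 ^ 2 + e p.1 * p.2 + 1 ∧
          deriv (deriv (h p.1)) p.2
            = a p.1 * (d p.1 * p.2 ^ 2 + e p.1 * p.2 + 1) ^ (-(3 / 2) : ℝ)) := by
  obtain ⟨s1, -⟩ := aux_smooth h V hV hh
  obtain ⟨s2, -⟩ := aux_smooth (fun x => deriv (h x)) V hV s1
  obtain ⟨s3, D3⟩ := aux_smooth (fun x => deriv (deriv (h x))) V hV s2
  obtain ⟨s4, D4⟩ := aux_smooth (fun x => deriv (deriv (deriv (h x)))) V hV s3
  obtain ⟨s5, D5⟩ := aux_smooth (fun x => deriv (deriv (deriv (deriv (h x))))) V hV s4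
  constructor
  · rintro ⟨hne, W, hWo, hW0, hWV, hode⟩
    set c := deriv (deriv (h 0)) 0 with hc
    -- neighbourhood on which h'' has the sign of c
    have hcont : ContinuousAt (fun p : (ℝ × ℝ) × ℝ => deriv (deriv (h p.1)) p.2 * c) 0 :=
      ((s2.continuousOn.continuousAt (hV.mem_nhds h0V)).mul continuousAt_const)
    have hpos0 : ∀ᶠ p in nhds (0 : (ℝ × ℝ) × ℝ), 0 < deriv (deriv (h p.1)) p.2 * c := by
      apply hcont.eventually_const_lt
      simpa [← hc] using mul_self_pos.mpr hne
    obtain ⟨r, hr, hball⟩ := Metric.mem_nhds_iff.mp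
      (Filter.inter_mem (hWo.mem_nhds hW0) hpos0)
    have hbox : ∀ x : ℝ × ℝ, x ∈ Metric.ball (0 : ℝ × ℝ) r → ∀ w ∈ Set.Ioo (-r) r,
        (x, w) ∈ W ∧ 0 < deriv (deriv (h x)) w * c := by
      intro x hx w hw
      have : (x, w) ∈ Metric.ball (0 : (ℝ × ℝ) × ℝ) r := by
        rw [show (0 : (ℝ × ℝ) × ℝ) = (0, 0) from rfl, ← ball_prod_same]
        refine ⟨hx, ?_⟩
        rw [Real.ball_eq_Ioo]
        simpa using hw
      exact hball this
    have h0r : (0 : ℝ) ∈ Set.Ioo (-r) r := by constructor <;> linarith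
    have hinc : ContDiffOn ℝ (⊤ : ℕ∞) (fun x : ℝ × ℝ => (x, (0 : ℝ))) (Metric.ball 0 r) :=
      (contDiff_id.prodMk contDiff_const).contDiffOn
    have hmaps : Set.MapsTo (fun x : ℝ × ℝ => (x, (0 : ℝ))) (Metric.ball 0 r) V :=
      fun x hx => hWV (hbox x hx 0 h0r).1
    have t2 := s2.comp hinc hmaps
    have t3 := s3.comp hinc hmaps
    have t4 := s4.comp hinc hmaps
    have hnz : ∀ x ∈ Metric.ball (0 : ℝ × ℝ) r, deriv (deriv (h x)) 0 ≠ 0 := by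
      intro x hx h0
      have := (hbox x hx 0 h0r).2
      simp [h0] at this
    refine ⟨fun x => deriv (deriv (h x)) 0,
      fun x => 5/9 * (deriv (deriv (deriv (h x))) 0 / deriv (deriv (h x)) 0) ^ 2
        - 1/3 * (deriv (deriv (deriv (deriv (h x)))) 0 / deriv (deriv (h x)) 0),
      fun x => -(2/3) * (deriv (deriv (deriv (h x))) 0 / deriv (deriv (h x)) 0),
      Metric.ball 0 r, Metric.isOpen_ball, Metric.mem_ball_self hr, t2, ?_, ?_, hne,
      Metric.ball 0 r ×ˢ Set.Ioo (-r) r, Metric.isOpen_ball.prod isOpen_Ioo,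
      ⟨Metric.mem_ball_self hr, h0r⟩, fun p hp => hWV (hbox p.1 hp.1 p.2 hp.2).1, ?_⟩
    · exact (contDiffOn_const.mul ((t3.div t2 hnz).pow 2)).sub
        (contDiffOn_const.mul (t4.div t2 hnz))
    · exact contDiffOn_const.mul (t3.div t2 hnz)
    · rintro ⟨x, w⟩ ⟨hx, hw⟩
      refine ⟨hx, ?_⟩
      simp only at hx hw ⊢
      set b := deriv (deriv (h x)) 0 with hb
      have hb0 : b ≠ 0 := hnz x hx
      have hbc := (hbox x hx 0 h0r).2
      have hm : ∀ w ∈ Set.Ioo (-r) r, (x, w) ∈ V := fun w hw => hWV (hbox x hx w hw).1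
      have := aux_forward (fun w => deriv (deriv (h x)) w / b)
        (fun w => deriv (deriv (deriv (h x))) w / b)
        (fun w => deriv (deriv (deriv (deriv (h x)))) w / b)
        (fun w => deriv (deriv (deriv (deriv (deriv (h x))))) w / b) r
        (fun w hw => (D3 (x, w) (hm w hw)).div_const b)
        (fun w hw => (D4 (x, w) (hm w hw)).div_const b)
        (fun w hw => (D5 (x, w) (hm w hw)).div_const b)
        (fun w hw => by
          have h1 := (hbox x hx w hw).2
          have h2 : deriv (deriv (h x)) w / b
            = (deriv (deriv (h x)) w * c) / (b * c) := by
            field_simp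
          rw [h2]
          exact div_pos h1 hbc)
        (div_self hb0)
        (fun w hw => by
          have := hode (x, w) (hbox x hx w hw).1
          simp only at this
          field_simp
          linear_combination this) w hw
      refine ⟨this.1, ?_⟩
      have h2 := this.2
      rw [← h2]
      field_simp
  · rintro ⟨a, d, e, U2, hU, h0U, -, -, -, ha, W, hWo, hW0, hWV, H⟩
    refine ⟨?_, W, hWo, hW0, hWV, ?_⟩
    · have := (H 0 hW0).2.2
      simp at this
      rw [this]
      exact ha
    · rintro ⟨x, w⟩ hp
      exact aux_backward (deriv (deriv (h x))) {w | (x, w) ∈ W}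
        (hWo.preimage (by fun_prop)) (a x) (d x) (e x)
        (fun w hw => (H (x, w) hw).2.1) (fun w hw => (H (x, w) hw).2.2) w hp
end
end

section
/- Let h(x,w) be smooth on a neighbourhood of 0 ∈ ℝ²×ℝ. There exist smooth functions a, d, e of x near 0 ∈ ℝ² with a(0) ≠ 0 such that ∂²h/∂w²(x,w) = a(x)·(d(x)w² + e(x)w + 1)^{−3/2} near 0 if and only if there exist smooth functions a, b, c, d, e of x with a(0) ≠ 0 such that h(x,w) = 2a(x)·w²/((√(p(x,w)) + 1)² − d(x)w²) + b(x)w + c(x) near 0, where p(x,w) = d(x)w² + e(x)w + 1. -/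
noncomputable section

open Set

/-- First derivative of the model function. -/
lemma model_deriv (d e w : ℝ) (hp : 0 < d * w ^ 2 + e * w + 1)
    (hD : 0 < (Real.sqrt (d * w ^ 2 + e * w + 1) + 1) ^ 2 - d * w ^ 2) :
    HasDerivAt (fun w : ℝ => 2 * w ^ 2 /
        ((Real.sqrt (d * w ^ 2 + e * w + 1) + 1) ^ 2 - d * w ^ 2))
      (2 * w * (Real.sqrt (d * w ^ 2 + e * w + 1) + 1) /
        (Real.sqrt (d * w ^ 2 + e * w + 1) *
          ((Real.sqrt (d * w ^ 2 + e * w + 1) + 1) ^ 2 - d * w ^ 2))) w := by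
  have hw := hasDerivAt_id' w
  have h1 : HasDerivAt (fun w : ℝ => d * w ^ 2 + e * w + 1) (2 * d * w + e) w := by
    refine ((((hw.pow 2).const_mul d).add (hw.const_mul e)).add_const (1 : ℝ)).congr_deriv ?_
    norm_num
    ring
  have h2 := h1.sqrt hp.ne'
  have h3 := (((h2.add_const 1).pow 2).sub ((hw.pow 2).const_mul d))
  have h4 := ((hw.pow 2).const_mul 2).div h3 hD.ne'
  have hs : 0 < Real.sqrt (d * w ^ 2 + e * w + 1) := Real.sqrt_pos.2 hp
  have hs2 := Real.sq_sqrt hp.le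
  refine h4.congr_deriv ?_
  simp only [Pi.sub_apply, Pi.pow_apply]
  generalize Real.sqrt (d * w ^ 2 + e * w + 1) = s at *
  have hD' := hD.ne'
  field_simp
  push_cast
  norm_num
  linear_combination 2 * w * (s + 1) * hs2

/-- Second derivative of the model function. -/
lemma model_deriv2 (d e w : ℝ) (hp : 0 < d * w ^ 2 + e * w + 1)
    (hD : 0 < (Real.sqrt (d * w ^ 2 + e * w + 1) + 1) ^ 2 - d * w ^ 2) :
    HasDerivAt (fun w : ℝ => 2 * w * (Real.sqrt (d * w ^ 2 + e * w + 1) + 1) /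
        (Real.sqrt (d * w ^ 2 + e * w + 1) *
          ((Real.sqrt (d * w ^ 2 + e * w + 1) + 1) ^ 2 - d * w ^ 2)))
      ((d * w ^ 2 + e * w + 1) ^ (-(3 / 2) : ℝ)) w := by
  have hw := hasDerivAt_id' w
  have h1 : HasDerivAt (fun w : ℝ => d * w ^ 2 + e * w + 1) (2 * d * w + e) w := by
    refine ((((hw.pow 2).const_mul d).add (hw.const_mul e)).add_const (1 : ℝ)).congr_deriv ?_
    norm_num
    ring
  have h2 := h1.sqrt hp.ne'
  have h3 := (((h2.add_const 1).pow 2).sub ((hw.pow 2).const_mul d))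
  have hs : 0 < Real.sqrt (d * w ^ 2 + e * w + 1) := Real.sqrt_pos.2 hp
  have h4 := ((hw.const_mul 2).mul (h2.add_const 1)).div (h2.mul h3) (mul_pos hs hD).ne'
  have hs2 := Real.sq_sqrt hp.le
  have hr : (d * w ^ 2 + e * w + 1) ^ (-(3 / 2) : ℝ)
      = ((Real.sqrt (d * w ^ 2 + e * w + 1)) ^ 3)⁻¹ := by
    rw [Real.rpow_neg hp.le, Real.sqrt_eq_rpow, ← Real.rpow_mul_natCast hp.le]
    norm_num
  rw [hr]
  refine h4.congr_deriv ?_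
  simp only [Pi.sub_apply, Pi.pow_apply, Pi.mul_apply]
  generalize Real.sqrt (d * w ^ 2 + e * w + 1) = s at *
  have hD' := hD.ne'
  have hD2 : (s + 1) ^ 2 - w ^ 2 * d ≠ 0 := by rwa [mul_comm (w ^ 2) d]
  field_simp
  push_cast
  norm_num
  linear_combination (((s + 1) ^ 2 - w ^ 2 * d) + 2 * s * (s + 1) ^ 2) * hs2

/-- A function with vanishing second derivative and vanishing 1-jet is zero. -/
lemma zero_of_deriv2 (r : ℝ) (hr : 0 < r) (f g : ℝ → ℝ)
    (hf : ∀ t ∈ Metric.ball (0 : ℝ) r, HasDerivAt f (g t) t)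
    (hg : ∀ t ∈ Metric.ball (0 : ℝ) r, HasDerivAt g 0 t)
    (f0 : f 0 = 0) (g0 : g 0 = 0) : ∀ t ∈ Metric.ball (0 : ℝ) r, f t = 0 := by
  have key : ∀ k : ℝ → ℝ, (∀ t ∈ Metric.ball (0 : ℝ) r, HasDerivAt k 0 t) → k 0 = 0 →
      ∀ t ∈ Metric.ball (0 : ℝ) r, k t = 0 := by
    intro k hk k0 t ht
    rw [← k0]
    refine Metric.isOpen_ball.is_const_of_deriv_eq_zero
      (convex_ball (0 : ℝ) r).isPreconnected
      (fun y hy => (hk y hy).differentiableAt.differentiableWithinAt)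
      (fun y hy => (hk y hy).deriv) ht (Metric.mem_ball_self hr)
  have hg0 := key g hg g0
  exact key f (fun t ht => by simpa [hg0 t ht] using hf t ht) f0

/-- Smoothness of slices. -/
lemma slice_smooth (h : (ℝ × ℝ) → ℝ → ℝ) (V : Set ((ℝ × ℝ) × ℝ)) (hV : IsOpen V)
    (hh : ContDiffOn ℝ (⊤ : ℕ∞) (fun p : (ℝ × ℝ) × ℝ => h p.1 p.2) V)
    (x : ℝ × ℝ) (t : ℝ) (ht : (x, t) ∈ V) :
    HasDerivAt (h x) (deriv (h x) t) t ∧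
    HasDerivAt (deriv (h x)) (deriv (deriv (h x)) t) t := by
  have h1 : ContDiffAt ℝ (⊤ : ℕ∞) (fun p : (ℝ × ℝ) × ℝ => h p.1 p.2) (x, t) :=
    hh.contDiffAt (hV.mem_nhds ht)
  have h2 : ContDiffAt ℝ (⊤ : ℕ∞) (h x) t :=
    h1.comp (f := fun t : ℝ => (x, t)) t (by fun_prop)
  refine ⟨(h2.differentiableAt (by simp)).hasDerivAt, ?_⟩
  have h2' : ContDiffAt ℝ 2 (h x) t := h2.of_le (WithTop.coe_le_coe.2 (le_top : (2 : ℕ∞) ≤ ⊤))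
  have h3 : ContDiffAt ℝ 1 (deriv (h x)) t := by
    have h4 : ContDiffAt ℝ 1 (fderiv ℝ (h x)) t := h2'.fderiv_right (by norm_num)
    exact h4.clm_apply contDiffAt_const
  exact (h3.differentiableAt (by simp)).hasDerivAt

/-- for `h(x,w)` smooth near `0 ∈ ℝ²×ℝ`: there are smooth `a, d, e` of `x`
with `a(0) ≠ 0` such that `∂²h/∂w² = a(x)·(d(x)w² + e(x)w + 1)^(−3/2)` near `0` iff there
are smooth `a, b, c, d, e` with `a(0) ≠ 0` such that
`h = 2a(x)·w²/((√p + 1)² − d(x)w²) + b(x)w + c(x)` near `0`, where `p = d(x)w² + e(x)w + 1`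
(with `p > 0` and `(√p + 1)² − d w² > 0` on the relevant neighbourhood). -/
theorem stmt_8 (h : (ℝ × ℝ) → ℝ → ℝ) (V : Set ((ℝ × ℝ) × ℝ))
    (hV : IsOpen V) (h0V : (0 : (ℝ × ℝ) × ℝ) ∈ V)
    (hh : ContDiffOn ℝ (⊤ : ℕ∞) (fun p : (ℝ × ℝ) × ℝ => h p.1 p.2) V) :
    (∃ (a d e : (ℝ × ℝ) → ℝ) (U2 : Set (ℝ × ℝ)),
      IsOpen U2 ∧ (0 : ℝ × ℝ) ∈ U2 ∧
      ContDiffOn ℝ (⊤ : ℕ∞) a U2 ∧ ContDiffOn ℝ (⊤ : ℕ∞) d U2 ∧ ContDiffOn ℝ (⊤ : ℕ∞) e U2 ∧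
      a 0 ≠ 0 ∧
      ∃ W : Set ((ℝ × ℝ) × ℝ), IsOpen W ∧ (0 : (ℝ × ℝ) × ℝ) ∈ W ∧ W ⊆ V ∧
        ∀ p ∈ W, p.1 ∈ U2 ∧
          0 < d p.1 * p.2 ^ 2 + e p.1 * p.2 + 1 ∧
          deriv (deriv (h p.1)) p.2
            = a p.1 * (d p.1 * p.2 ^ 2 + e p.1 * p.2 + 1) ^ (-(3 / 2) : ℝ))
    ↔
    (∃ (a b c d e : (ℝ × ℝ) → ℝ) (U2 : Set (ℝ × ℝ)),
      IsOpen U2 ∧ (0 : ℝ × ℝ) ∈ U2 ∧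
      ContDiffOn ℝ (⊤ : ℕ∞) a U2 ∧ ContDiffOn ℝ (⊤ : ℕ∞) b U2 ∧ ContDiffOn ℝ (⊤ : ℕ∞) c U2 ∧
      ContDiffOn ℝ (⊤ : ℕ∞) d U2 ∧ ContDiffOn ℝ (⊤ : ℕ∞) e U2 ∧
      a 0 ≠ 0 ∧
      ∃ W : Set ((ℝ × ℝ) × ℝ), IsOpen W ∧ (0 : (ℝ × ℝ) × ℝ) ∈ W ∧ W ⊆ V ∧
        ∀ p ∈ W, p.1 ∈ U2 ∧
          0 < d p.1 * p.2 ^ 2 + e p.1 * p.2 + 1 ∧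
          0 < (Real.sqrt (d p.1 * p.2 ^ 2 + e p.1 * p.2 + 1) + 1) ^ 2 - d p.1 * p.2 ^ 2 ∧
          h p.1 p.2
            = 2 * a p.1 * p.2 ^ 2
                / ((Real.sqrt (d p.1 * p.2 ^ 2 + e p.1 * p.2 + 1) + 1) ^ 2
                    - d p.1 * p.2 ^ 2)
              + b p.1 * p.2 + c p.1) := by
  constructor
  · rintro ⟨a, d, e, U2, hU, h0U, ha, hd, he, ha0, W, hW, h0W, hWV, hp⟩
    let S : Set (ℝ × ℝ) := U2 ∩ {x | (x, (0 : ℝ)) ∈ V}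
    have hS1 : IsOpen {x : ℝ × ℝ | (x, (0 : ℝ)) ∈ V} :=
      hV.preimage (f := fun x : ℝ × ℝ => (x, (0 : ℝ))) (by fun_prop)
    have hS : IsOpen S := hU.inter hS1
    have h0S : (0 : ℝ × ℝ) ∈ S := ⟨h0U, h0V⟩
    have hc : ContDiffOn ℝ (⊤ : ℕ∞) (fun x => h x 0) S :=
      hh.comp (f := fun x : ℝ × ℝ => (x, (0 : ℝ))) (by fun_prop) (fun x hx => hx.2)
    have hb : ContDiffOn ℝ (⊤ : ℕ∞) (fun x => deriv (h x) 0) S := by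
      have h1 : ContDiffOn ℝ (⊤ : ℕ∞)
          (fderiv ℝ (fun p : (ℝ × ℝ) × ℝ => h p.1 p.2)) V :=
        hh.fderiv_of_isOpen hV (by simp)
      have h2 : ContDiffOn ℝ (⊤ : ℕ∞) (fun x : ℝ × ℝ =>
          fderiv ℝ (fun p : (ℝ × ℝ) × ℝ => h p.1 p.2) (x, 0) (0, 1)) S :=
        (h1.comp (f := fun x : ℝ × ℝ => (x, (0 : ℝ))) (by fun_prop)
          (fun x hx => hx.2)).clm_apply contDiffOn_const
      refine h2.congr fun x hx => ?_
      have h3 : HasFDerivAt (fun p : (ℝ × ℝ) × ℝ => h p.1 p.2) _ (x, (0 : ℝ)) :=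
        ((hh.contDiffAt (hV.mem_nhds hx.2)).differentiableAt (by simp)).hasFDerivAt
      have h4 : HasDerivAt (fun t : ℝ => (x, t)) ((0 : ℝ × ℝ), (1 : ℝ)) 0 :=
        (hasDerivAt_const (0 : ℝ) x).prodMk (hasDerivAt_id' 0)
      exact (h3.comp_hasDerivAt (0 : ℝ) h4).deriv
    have hev : ∀ᶠ p : (ℝ × ℝ) × ℝ in nhds 0,
        0 < (Real.sqrt (d p.1 * p.2 ^ 2 + e p.1 * p.2 + 1) + 1) ^ 2 - d p.1 * p.2 ^ 2 := by
      have hdc : ContinuousAt (fun p : (ℝ × ℝ) × ℝ => d p.1) 0 :=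
        (hd.continuousOn.continuousAt (hU.mem_nhds h0U)).comp
          (f := fun p : (ℝ × ℝ) × ℝ => p.1) (x := 0) continuousAt_fst
      have hec : ContinuousAt (fun p : (ℝ × ℝ) × ℝ => e p.1) 0 :=
        (he.continuousOn.continuousAt (hU.mem_nhds h0U)).comp
          (f := fun p : (ℝ × ℝ) × ℝ => p.1) (x := 0) continuousAt_fst
      have hcont : ContinuousAt (fun p : (ℝ × ℝ) × ℝ =>
        (Real.sqrt (d p.1 * p.2 ^ 2 + e p.1 * p.2 + 1) + 1) ^ 2 - d p.1 * p.2 ^ 2) 0 := by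
        have hsn : ContinuousAt (fun p : (ℝ × ℝ) × ℝ => p.2) 0 := continuousAt_snd
        exact (((((hdc.mul (hsn.pow 2)).add (hec.mul hsn)).add continuousAt_const).sqrt.add
          continuousAt_const).pow 2).sub (hdc.mul (hsn.pow 2))
      refine hcont.eventually_mem (isOpen_Ioi.mem_nhds ?_)
      simp
    have hev2 : ∀ᶠ p : (ℝ × ℝ) × ℝ in nhds 0, p.1 ∈ S :=
      continuousAt_fst.eventually_mem (hS.mem_nhds h0S)
    obtain ⟨r, hr, hball⟩ := Metric.eventually_nhds_iff_ball.1
      ((hev.and hev2).and (hW.eventually_mem h0W))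
    refine ⟨a, fun x => deriv (h x) 0, fun x => h x 0, d, e, S, hS, h0S,
      ha.mono inter_subset_left, hb, hc, hd.mono inter_subset_left, he.mono inter_subset_left,
      ha0, Metric.ball 0 r, Metric.isOpen_ball, Metric.mem_ball_self hr,
      fun p hpb => hWV (hball p hpb).2, ?_⟩
    rintro ⟨x, w⟩ hq
    obtain ⟨⟨hq1, hq2⟩, hq3⟩ := hball _ hq
    refine ⟨hq2, (hp _ hq3).2.1, hq1, ?_⟩
    have hxw : x ∈ Metric.ball (0 : ℝ × ℝ) r ∧ w ∈ Metric.ball (0 : ℝ) r := by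
      rw [show (0 : (ℝ × ℝ) × ℝ) = (0, 0) from rfl, ← ball_prod_same] at hq
      exact hq
    have hin : ∀ t ∈ Metric.ball (0 : ℝ) r, (x, t) ∈ Metric.ball (0 : (ℝ × ℝ) × ℝ) r := by
      intro t ht
      rw [show (0 : (ℝ × ℝ) × ℝ) = (0, 0) from rfl, ← ball_prod_same]
      exact ⟨hxw.1, ht⟩
    have hz := zero_of_deriv2 r hr
      (fun t => h x t - (a x * (2 * t ^ 2 /
        ((Real.sqrt (d x * t ^ 2 + e x * t + 1) + 1) ^ 2 - d x * t ^ 2))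
          + deriv (h x) 0 * t + h x 0))
      (fun t => deriv (h x) t - (a x * (2 * t * (Real.sqrt (d x * t ^ 2 + e x * t + 1) + 1) /
        (Real.sqrt (d x * t ^ 2 + e x * t + 1) *
          ((Real.sqrt (d x * t ^ 2 + e x * t + 1) + 1) ^ 2 - d x * t ^ 2)))
          + deriv (h x) 0))
      (fun t ht => by
        obtain ⟨⟨g1, _⟩, g3⟩ := hball _ (hin t ht)
        have k := (slice_smooth h V hV hh x t (hWV g3)).1
        have m := model_deriv (d x) (e x) t (hp _ g3).2.1 g1
        refine (k.sub (((m.const_mul (a x)).add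
          ((hasDerivAt_id' t).const_mul (deriv (h x) 0))).add_const (h x 0))).congr_deriv ?_
        ring)
      (fun t ht => by
        obtain ⟨⟨g1, _⟩, g3⟩ := hball _ (hin t ht)
        have k := (slice_smooth h V hV hh x t (hWV g3)).2
        have m := model_deriv2 (d x) (e x) t (hp _ g3).2.1 g1
        refine (k.sub ((m.const_mul (a x)).add_const (deriv (h x) 0))).congr_deriv ?_
        rw [(hp _ g3).2.2]
        simp)
      (by simp) (by simp) w hxw.2
    have hz' := sub_eq_zero.1 hz
    simp only at hz' ⊢
    rw [hz']
    ring
  · rintro ⟨a, b, c, d, e, U2, hU, h0U, ha, hb, hc, hd, he, ha0, W, hW, h0W, hWV, hp⟩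
    refine ⟨a, d, e, U2, hU, h0U, ha, hd, he, ha0, W, hW, h0W, hWV, ?_⟩
    rintro ⟨x, w⟩ hq
    refine ⟨(hp _ hq).1, (hp _ hq).2.1, ?_⟩
    simp only
    have hTo : IsOpen {t : ℝ | (x, t) ∈ W} :=
      hW.preimage (f := fun t : ℝ => (x, t)) (by fun_prop)
    have hd1 : ∀ t ∈ {t : ℝ | (x, t) ∈ W}, deriv (h x) t =
        a x * (2 * t * (Real.sqrt (d x * t ^ 2 + e x * t + 1) + 1) /
        (Real.sqrt (d x * t ^ 2 + e x * t + 1) *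
          ((Real.sqrt (d x * t ^ 2 + e x * t + 1) + 1) ^ 2 - d x * t ^ 2)))
          + b x := by
      intro t ht
      obtain ⟨_, g1, g2, _⟩ := hp _ ht
      have m := (((model_deriv (d x) (e x) t g1 g2).const_mul (a x)).add
          ((hasDerivAt_id' t).const_mul (b x))).add_const (c x)
      have heq : h x =ᶠ[nhds t] fun y => a x * (2 * y ^ 2 /
          ((Real.sqrt (d x * y ^ 2 + e x * y + 1) + 1) ^ 2 - d x * y ^ 2)) + b x * y + c x := by
        filter_upwards [hTo.mem_nhds ht] with u hu
        have h5 := (hp _ hu).2.2.2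
        simp only at h5
        rw [h5]
        ring
      rw [(m.congr_of_eventuallyEq heq).deriv]
      ring
    obtain ⟨_, g1, g2, _⟩ := hp _ hq
    have m := ((model_deriv2 (d x) (e x) w g1 g2).const_mul (a x)).add_const (b x)
    refine (m.congr_of_eventuallyEq ?_).deriv
    filter_upwards [hTo.mem_nhds hq] with u hu
    exact hd1 u hu
end
end

section
/- Let I ⊆ ℝ be an open interval containing 0 and let ρ: I → ℝ be a smooth function satisfying 3ρ'' − 6ρρ' + (4/3)ρ³ = 0 on I. Then there exist real constants d, e and an open subinterval J ⊆ I containing 0 such that ρ(w) = −(3/2)·(2dw + e)/(dw² + ew + 1) for all w ∈ J. -/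
theorem const_of_hasDerivAt_zero_Ioo (a b : ℝ) (f : ℝ → ℝ) (h0 : (0 : ℝ) ∈ Set.Ioo a b)
    (hf : ∀ w ∈ Set.Ioo a b, HasDerivAt f 0 w) : ∀ w ∈ Set.Ioo a b, f w = f 0 := by
  intro w hw
  exact isOpen_Ioo.is_const_of_deriv_eq_zero isPreconnected_Ioo
    (fun x hx => (hf x hx).differentiableAt.differentiableWithinAt)
    (fun x hx => (hf x hx).deriv) hw h0

/-- If `ρ` is smooth on an open interval `I = (a,b)` containing `0` and satisfies
`3ρ'' − 6ρρ' + (4/3)ρ³ = 0` on `I`, then there exist real constants `d, e` and an open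
subinterval `J = (a',b') ⊆ I` containing `0` on which
`ρ(w) = −(3/2)·(2dw + e)/(dw² + ew + 1)` (with positive denominator). -/
theorem stmt_9 (a b : ℝ) (ρ : ℝ → ℝ)
    (h0 : (0 : ℝ) ∈ Set.Ioo a b)
    (hρ : ContDiffOn ℝ (⊤ : ℕ∞) ρ (Set.Ioo a b))
    (hode : ∀ w ∈ Set.Ioo a b,
      3 * deriv (deriv ρ) w - 6 * ρ w * deriv ρ w + (4 / 3) * (ρ w) ^ 3 = 0) :
    ∃ d e a' b' : ℝ, Set.Ioo a' b' ⊆ Set.Ioo a b ∧ (0 : ℝ) ∈ Set.Ioo a' b' ∧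
      ∀ w ∈ Set.Ioo a' b',
        0 < d * w ^ 2 + e * w + 1 ∧
        ρ w = -(3 / 2) * (2 * d * w + e) / (d * w ^ 2 + e * w + 1) := by
  have hop : IsOpen (Set.Ioo a b) := isOpen_Ioo
  have h1 : ∀ w ∈ Set.Ioo a b, HasDerivAt ρ (deriv ρ w) w := fun w hw =>
    ((hρ.differentiableOn (by simp)).differentiableAt (hop.mem_nhds hw)).hasDerivAt
  have hρ' : ContDiffOn ℝ 1 (deriv ρ) (Set.Ioo a b) :=
    hρ.deriv_of_isOpen hop (WithTop.coe_le_coe.2 (le_top : (1 + 1 : ℕ∞) ≤ ⊤))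
  have h2 : ∀ w ∈ Set.Ioo a b, HasDerivAt (deriv ρ) (deriv (deriv ρ) w) w := fun w hw =>
    ((hρ'.differentiableOn (by simp)).differentiableAt (hop.mem_nhds hw)).hasDerivAt
  have hc : ContinuousOn ρ (Set.Ioo a b) := hρ.continuousOn
  obtain ⟨F, hF0, hF⟩ : ∃ F : ℝ → ℝ, F 0 = 0 ∧ ∀ w ∈ Set.Ioo a b, HasDerivAt F (ρ w) w := by
    refine ⟨fun w => ∫ t in (0 : ℝ)..w, ρ t, by simp, fun w hw => ?_⟩
    apply intervalIntegral.integral_hasDerivAt_right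
    · exact (hc.mono (Set.ordConnected_Ioo.uIcc_subset h0 hw)).intervalIntegrable
    · exact hc.stronglyMeasurableAtFilter hop w hw
    · exact hc.continuousAt (hop.mem_nhds hw)
  set u : ℝ → ℝ := fun w => Real.exp (-(2 / 3) * F w) with hu
  have hu0 : u 0 = 1 := by simp [hu, hF0]
  have hupos : ∀ w, 0 < u w := fun w => Real.exp_pos _
  have hu1 : ∀ w ∈ Set.Ioo a b, HasDerivAt u (-(2 / 3) * ρ w * u w) w := by
    intro w hw
    have := ((hF w hw).const_mul (-(2 / 3))).exp
    convert this using 1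
    simp only [hu]; ring
  have hv1 : ∀ w ∈ Set.Ioo a b, HasDerivAt (fun x => -(2 / 3) * ρ x * u x)
      ((-(2 / 3) * deriv ρ w + 4 / 9 * ρ w ^ 2) * u w) w := by
    intro w hw
    have := ((h1 w hw).const_mul (-(2 / 3))).mul (hu1 w hw)
    refine this.congr_deriv ?_
    ring
  have hk := const_of_hasDerivAt_zero_Ioo a b
    (fun w => (-(2 / 3) * deriv ρ w + 4 / 9 * ρ w ^ 2) * u w) h0 (by
      intro w hw
      have := (((h2 w hw).const_mul (-(2 / 3))).add (((h1 w hw).pow 2).const_mul (4 / 9))).mul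
        (hu1 w hw)
      refine this.congr_deriv ?_
      simp only [Pi.add_apply, Pi.pow_apply]
      push_cast
      linear_combination (-(2 / 9) * u w) * hode w hw)
  obtain ⟨k, hkk⟩ : ∃ k, k = (-(2 / 3) * deriv ρ 0 + 4 / 9 * ρ 0 ^ 2) * u 0 := ⟨_, rfl⟩
  simp only [← hkk] at hk
  have hl := const_of_hasDerivAt_zero_Ioo a b
    (fun w => -(2 / 3) * ρ w * u w - k * w) h0 (by
      intro w hw
      refine ((hv1 w hw).sub ((hasDerivAt_id w).const_mul k)).congr_deriv ?_
      rw [hk w hw]; ring)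
  obtain ⟨e, he⟩ : ∃ e, e = -(2 / 3) * ρ 0 * u 0 - k * 0 := ⟨_, rfl⟩
  simp only [← he] at hl
  have hm := const_of_hasDerivAt_zero_Ioo a b
    (fun w => u w - (k / 2 * w ^ 2 + e * w)) h0 (by
      intro w hw
      refine ((hu1 w hw).sub ((((hasDerivAt_id w).pow 2).const_mul (k / 2)).add
        ((hasDerivAt_id w).const_mul e))).congr_deriv ?_
      simp only [id]
      push_cast
      linear_combination hl w hw)
  refine ⟨k / 2, e, a, b, subset_rfl, h0, fun w hw => ?_⟩
  have hmw := hm w hw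
  have hlw := hl w hw
  simp only [hu0] at hmw
  have huw : k / 2 * w ^ 2 + e * w + 1 = u w := by linear_combination -hmw
  rw [huw]
  refine ⟨hupos w, ?_⟩
  rw [eq_div_iff (hupos w).ne']
  linear_combination (-(3 / 2)) * hlw
end

section
/- Consider the control-affine system Σ_h on ℝ³ near 0: ż = h(z,y,w), ẏ = w + ε, ẇ = u, with ε ∈ {0,1}, where h(x,w) = 2a(x)w²/((√(p)+1)² − d(x)w²) + b(x)w + c(x), p = d(x)w² + e(x)w + 1, x = (z,y), and a, b, c, d, e smooth with a(0) ≠ 0. Then, locally around 0: Σ_h is feedback equivalent to a parabolic system Σ_P if and only if d ≡ 0 on a neighbourhood of 0 ∈ ℝ²; Σ_h is feedback equivalent to an elliptic system Σ_E if and only if d(0) < 0; and Σ_h is feedback equivalent to a hyperbolic system Σ_H if and only if d(0) > 0. -/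
noncomputable section

open Set

/-- `ℝ³`, with coordinates `ξ = (x, w) = ((z,y), w)`. -/
abbrev M3 := (ℝ × ℝ) × ℝ

/-- Local feedback equivalence at `ξ₀` of the control-affine system `ξ̇ = f + g u` with the
system `ξ̇ = f' + g' u'` defined on `V`. -/
def FbEquivAff (f g : M3 → M3) (ξ₀ : M3) (f' g' : M3 → M3) (V : Set M3) : Prop :=
  ∃ (Φ : M3 → M3) (α β : M3 → ℝ) (U : Set M3),
    IsOpen U ∧ ξ₀ ∈ U ∧
    ContDiffOn ℝ (⊤ : ℕ∞) Φ U ∧ (∀ ξ ∈ U, Function.Bijective (fderiv ℝ Φ ξ)) ∧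
    (∀ ξ ∈ U, Φ ξ ∈ V) ∧
    ContDiffOn ℝ (⊤ : ℕ∞) α U ∧ ContDiffOn ℝ (⊤ : ℕ∞) β U ∧ (∀ ξ ∈ U, β ξ ≠ 0) ∧
    (∀ ξ ∈ U, fderiv ℝ Φ ξ (f ξ + α ξ • g ξ) = f' (Φ ξ)) ∧
    (∀ ξ ∈ U, fderiv ℝ Φ ξ (β ξ • g ξ) = g' (Φ ξ))

/-- Feedback equivalence at `ξ₀` to a second extension `ẋ = c₁(w)A(x) + c₂(w)B(x) + C(x),
ẇ = u` with `A, B, C` smooth vector fields on `ℝ²`, `A(x), B(x)` linearly independent;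
`c₁ = cos, c₂ = sin` gives the elliptic class `Σ_E`, `cosh/sinh` the hyperbolic class
`Σ_H`, and `w²/w` the parabolic class `Σ_P`. -/
def EquivToQuadClass (f g : M3 → M3) (ξ₀ : M3) (c₁ c₂ : ℝ → ℝ) : Prop :=
  ∃ (A B C : (ℝ × ℝ) → ℝ × ℝ) (V2 : Set (ℝ × ℝ)), IsOpen V2 ∧
    ContDiffOn ℝ (⊤ : ℕ∞) A V2 ∧ ContDiffOn ℝ (⊤ : ℕ∞) B V2 ∧ ContDiffOn ℝ (⊤ : ℕ∞) C V2 ∧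
    (∀ x ∈ V2, LinearIndependent ℝ ![A x, B x]) ∧
    FbEquivAff f g ξ₀
      (fun ξ => ((c₁ ξ.2 • A ξ.1 + c₂ ξ.2 • B ξ.1 + C ξ.1, (0 : ℝ)) : M3))
      (fun _ => (((0 : ℝ × ℝ), (1 : ℝ)) : M3)) (V2 ×ˢ univ)

lemma aux_coeff (c₀ c₁ c₂ c₃ c₄ : ℝ)
    (hP : Polynomial.C c₀ + Polynomial.C c₁ * Polynomial.X + Polynomial.C c₂ * Polynomial.X ^ 2
      + Polynomial.C c₃ * Polynomial.X ^ 3 + Polynomial.C c₄ * Polynomial.X ^ 4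
      = (0 : Polynomial ℝ)) : c₀ = 0 ∧ c₁ = 0 ∧ c₂ = 0 ∧ c₃ = 0 ∧ c₄ = 0 := by
  refine ⟨?_, ?_, ?_, ?_, ?_⟩
  · simpa [Polynomial.coeff_X, Polynomial.coeff_C] using congrArg (fun P => P.coeff 0) hP
  · simpa [Polynomial.coeff_X, Polynomial.coeff_C] using congrArg (fun P => P.coeff 1) hP
  · simpa [Polynomial.coeff_X, Polynomial.coeff_C] using congrArg (fun P => P.coeff 2) hP
  · simpa [Polynomial.coeff_X, Polynomial.coeff_C] using congrArg (fun P => P.coeff 3) hP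
  · simpa [Polynomial.coeff_X, Polynomial.coeff_C] using congrArg (fun P => P.coeff 4) hP

open Filter Topology in
lemma aux_rigid (k e : ℝ) (H : ℝ → ℝ) (α β γ δ η ζ : ℝ)
    (hH : ∀ᶠ w in 𝓝 (0 : ℝ), k * H w ^ 2 - e * H w * w + w ^ 2 - 2 * H w = 0)
    (hQ : ∀ᶠ w in 𝓝 (0 : ℝ),
      α * H w ^ 2 + β * H w * w + γ * w ^ 2 + δ * H w + η * w + ζ = 0) :
    δ = -2 * γ ∧ β = -e * γ ∧ α = k * γ := by
  obtain ⟨r, hr, hall⟩ := Metric.eventually_nhds_iff.1 (hH.and hQ)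
  have key : ∀ w ∈ Ioo (0 : ℝ) r, w * (k * (H w / w) ^ 2 - e * (H w / w) + 1) = 2 * (H w / w) ∧
      H w = (H w / w) * w ∧
      α * H w ^ 2 + β * H w * w + γ * w ^ 2 + δ * H w + η * w + ζ = 0 := by
    intro w hw
    have hw0 : w ≠ 0 := hw.1.ne'
    have h := hall (y := w) (by
      rw [Real.dist_eq, sub_zero, abs_of_pos hw.1]; exact hw.2)
    refine ⟨?_, by field_simp, h.2⟩
    field_simp
    linarith [h.1]
  set m : ℝ → ℝ := fun w => H w / w with hm
  have hinj : InjOn m (Ioo 0 r) := by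
    intro w hw v hv hwv
    have h1 := (key w hw).1
    have h2 := (key v hv).1
    have e1 : H w / w = H v / v := hwv
    rw [e1] at h1
    set n := H v / v
    have hD : k * n ^ 2 - e * n + 1 ≠ 0 := by
      intro h0
      rw [h0] at h1
      have : n = 0 := by linarith
      rw [this] at h0
      norm_num at h0
    exact mul_right_cancel₀ hD (h1.trans h2.symm)
  have hinf : (m '' Ioo 0 r).Infinite := (Set.Ioo_infinite hr).image hinj
  let P : Polynomial ℝ :=
    Polynomial.C ζ + Polynomial.C (2 * η - 2 * e * ζ) * Polynomial.X
      + Polynomial.C (4 * γ + 2 * δ - 2 * e * η + (2 * k + e ^ 2) * ζ) * Polynomial.X ^ 2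
      + Polynomial.C (4 * β - 2 * δ * e + 2 * η * k - 2 * k * e * ζ) * Polynomial.X ^ 3
      + Polynomial.C (4 * α + 2 * δ * k + k ^ 2 * ζ) * Polynomial.X ^ 4
  have hP : P = 0 := by
    apply Polynomial.eq_zero_of_infinite_isRoot
    refine hinf.mono ?_
    rintro _ ⟨w, hw, rfl⟩
    obtain ⟨h1, h2, h3⟩ := key w hw
    simp only [Set.mem_ofPred_eq, Polynomial.IsRoot, P, hm]
    simp only [Polynomial.eval_add, Polynomial.eval_mul, Polynomial.eval_C, Polynomial.eval_X,
      Polynomial.eval_pow]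
    generalize H w / w = n at *
    rw [h2] at h3
    generalize hDD : k * n ^ 2 - e * n + 1 = D at h1
    have h4 : α * (2 * n ^ 2) ^ 2 + β * (2 * n ^ 2) * (2 * n) + γ * (2 * n) ^ 2
        + δ * (2 * n ^ 2) * D + η * (2 * n) * D + ζ * D ^ 2 = 0 := by
      have : (α * (n * w) ^ 2 + β * (n * w) * w + γ * w ^ 2 + δ * (n * w) + η * w + ζ) * D ^ 2
        = 0 := by rw [h3, zero_mul]
      have h5 : 2 * n ^ 2 = n * (w * D) := by rw [h1]; ring
      rw [h5, ← h1]
      linarith [this]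
    rw [← hDD] at h4
    linarith [h4]
  obtain ⟨c0, c1, c2, c3, c4⟩ := aux_coeff _ _ _ _ _ hP
  subst c0
  have hη : η = 0 := by linarith
  subst hη
  have hδ : δ = -2 * γ := by linarith
  subst hδ
  refine ⟨rfl, by linarith, by linarith⟩

lemma aux_LI (A B : ℝ × ℝ) : LinearIndependent ℝ ![A, B] ↔ A.1 * B.2 - A.2 * B.1 ≠ 0 := by
  rw [LinearIndependent.pair_iff]
  constructor
  · intro h h0
    have h1 := h B.2 (-A.2) (by ext <;> simp <;> linarith)
    have h2 := h B.1 (-A.1) (by ext <;> simp <;> linarith)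
    have h3 := h 1 0 (by
      ext
      · simpa using h2.2
      · simpa using h1.2)
    exact one_ne_zero h3.1
  · intro h s t hst
    have h1 : s * A.1 + t * B.1 = 0 := by simpa using congrArg Prod.fst hst
    have h2 : s * A.2 + t * B.2 = 0 := by simpa using congrArg Prod.snd hst
    constructor
    · refine (mul_eq_zero.1 (?_ : s * (A.1 * B.2 - A.2 * B.1) = 0)).resolve_right h
      linear_combination B.2 * h1 - B.1 * h2
    · refine (mul_eq_zero.1 (?_ : t * (A.1 * B.2 - A.2 * B.1) = 0)).resolve_right h
      linear_combination A.1 * h2 - A.2 * h1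

/-- Sufficiency: an explicit representation of the fibre curves gives the equivalence. -/
lemma aux_suff (h θ : M3 → ℝ) (ε : ℝ) (c₁ c₂ : ℝ → ℝ) (hc₁ : Differentiable ℝ c₁)
    (hc₂ : Differentiable ℝ c₂) (A B C : (ℝ × ℝ) → ℝ × ℝ) (V2 : Set (ℝ × ℝ)) (hV : IsOpen V2)
    (hA : ContDiffOn ℝ (⊤ : ℕ∞) A V2) (hB : ContDiffOn ℝ (⊤ : ℕ∞) B V2)
    (hC : ContDiffOn ℝ (⊤ : ℕ∞) C V2)
    (hLI : ∀ x ∈ V2, (A x).1 * (B x).2 - (A x).2 * (B x).1 ≠ 0)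
    (hev : ∀ᶠ ξ in nhds (0 : M3), ContDiffAt ℝ (⊤ : ℕ∞) h ξ ∧ ContDiffAt ℝ (⊤ : ℕ∞) θ ξ ∧
      ξ.1 ∈ V2 ∧ ((h ξ, ξ.2 + ε) : ℝ × ℝ) = c₁ (θ ξ) • A ξ.1 + c₂ (θ ξ) • B ξ.1 + C ξ.1) :
    EquivToQuadClass (fun ξ => (((h ξ, ξ.2 + ε), (0 : ℝ)) : M3))
      (fun _ => (((0 : ℝ × ℝ), (1 : ℝ)) : M3)) 0 c₁ c₂ := by
  refine ⟨A, B, C, V2, hV, hA, hB, hC, fun x hx => (aux_LI _ _).2 (hLI x hx), ?_⟩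
  obtain ⟨W, hW, hWo, h0⟩ := eventually_nhds_iff.1 hev
  have hθd : ∀ ξ ∈ W, DifferentiableAt ℝ θ ξ := fun ξ hξ =>
    (hW ξ hξ).2.1.differentiableAt (by simp)
  have hθ : ContDiffOn ℝ (⊤ : ℕ∞) θ W := fun ξ hξ => (hW ξ hξ).2.1.contDiffWithinAt
  have hh : ContDiffOn ℝ (⊤ : ℕ∞) h W := fun ξ hξ => (hW ξ hξ).1.contDiffWithinAt
  have hne : ∀ ξ ∈ W, fderiv ℝ θ ξ ((0 : ℝ × ℝ), (1 : ℝ)) ≠ 0 := by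
    rintro ⟨x, w⟩ hξ hz
    have hline : HasDerivAt (fun s : ℝ => ((x, s) : M3)) ((0 : ℝ × ℝ), (1 : ℝ)) w :=
      (hasDerivAt_const w x).prodMk (hasDerivAt_id w)
    have hth : HasDerivAt (fun s : ℝ => θ (x, s)) 0 w := by
      have := (hθd _ hξ).hasFDerivAt.comp_hasDerivAt w hline
      rw [hz] at this
      exact this
    have h1 : HasDerivAt (fun s : ℝ => c₁ (θ (x, s)) * (A x).2 + c₂ (θ (x, s)) * (B x).2
        + (C x).2) 0 w := by
      have e1 := ((hc₁ (θ (x, w))).hasDerivAt.comp w hth).mul_const (A x).2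
      have e2 := ((hc₂ (θ (x, w))).hasDerivAt.comp w hth).mul_const (B x).2
      have := (e1.add e2).add_const (C x).2
      simpa using this
    have h2 : HasDerivAt (fun s : ℝ => s + ε) 1 w := (hasDerivAt_id w).add_const ε
    have h3 : (fun s : ℝ => c₁ (θ (x, s)) * (A x).2 + c₂ (θ (x, s)) * (B x).2
        + (C x).2) =ᶠ[nhds w] fun s : ℝ => s + ε := by
      have : ∀ᶠ s in nhds w, ((x, s) : M3) ∈ W :=
        hline.continuousAt.eventually (hWo.mem_nhds hξ)
      filter_upwards [this] with s hs
      have := congrArg Prod.snd (hW _ hs).2.2.2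
      simpa using this.symm
    exact zero_ne_one (h1.unique (h2.congr_of_eventuallyEq h3))
  have hfd : ContDiffOn ℝ (⊤ : ℕ∞) (fderiv ℝ θ) W :=
    hθ.fderiv_of_isOpen hWo (by simp)
  refine ⟨fun ξ => (ξ.1, θ ξ),
    fun ξ => -(fderiv ℝ θ ξ ((h ξ, ξ.2 + ε), (0 : ℝ))) / fderiv ℝ θ ξ ((0 : ℝ × ℝ), (1 : ℝ)),
    fun ξ => (fderiv ℝ θ ξ ((0 : ℝ × ℝ), (1 : ℝ)))⁻¹, W, hWo, h0, ?_, ?_, ?_, ?_, ?_, ?_, ?_, ?_⟩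
  · exact contDiff_fst.contDiffOn.prodMk hθ
  · intro ξ hξ
    have hF : fderiv ℝ (fun ξ : M3 => ((ξ.1, θ ξ) : M3)) ξ
        = (ContinuousLinearMap.fst ℝ (ℝ × ℝ) ℝ).prod (fderiv ℝ θ ξ) :=
      (hasFDerivAt_fst.prodMk (hθd ξ hξ).hasFDerivAt).fderiv
    rw [hF]
    have hi : Function.Injective ((ContinuousLinearMap.fst ℝ (ℝ × ℝ) ℝ).prod (fderiv ℝ θ ξ)) := by
      rw [injective_iff_map_eq_zero]
      rintro ⟨v, s⟩ hv
      have hv1 : v = 0 := congrArg Prod.fst hv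
      have hv2 : fderiv ℝ θ ξ (v, s) = 0 := congrArg Prod.snd hv
      subst hv1
      have : ((0 : ℝ × ℝ), s) = s • ((0 : ℝ × ℝ), (1 : ℝ)) := by simp
      rw [this, map_smul, smul_eq_mul] at hv2
      have := (mul_eq_zero.1 hv2).resolve_right (hne ξ hξ)
      rw [this]; rfl
    exact ⟨hi, (LinearMap.injective_iff_surjective (f := (((ContinuousLinearMap.fst ℝ (ℝ × ℝ) ℝ).prod
      (fderiv ℝ θ ξ) : M3 →L[ℝ] M3) : M3 →ₗ[ℝ] M3))).1 hi⟩
  · intro ξ hξ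
    exact ⟨(hW ξ hξ).2.2.1, trivial⟩
  · refine ContDiffOn.div (ContDiffOn.neg ?_) (hfd.clm_apply contDiffOn_const) hne
    exact hfd.clm_apply ((hh.prodMk (contDiff_snd.contDiffOn.add contDiffOn_const)).prodMk
      contDiffOn_const)
  · exact (hfd.clm_apply contDiffOn_const).inv hne
  · intro ξ hξ
    exact inv_ne_zero (hne ξ hξ)
  · intro ξ hξ
    have hF : fderiv ℝ (fun ξ : M3 => ((ξ.1, θ ξ) : M3)) ξ
        = (ContinuousLinearMap.fst ℝ (ℝ × ℝ) ℝ).prod (fderiv ℝ θ ξ) :=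
      (hasFDerivAt_fst.prodMk (hθd ξ hξ).hasFDerivAt).fderiv
    rw [hF]
    refine Prod.ext ?_ ?_
    · have := (hW ξ hξ).2.2.2
      simpa using this
    · have := hne ξ hξ
      simp only [ContinuousLinearMap.prod_apply, map_add, map_smul, Prod.snd_add,
        Prod.smul_snd, smul_eq_mul]
      field_simp
      ring
  · intro ξ hξ
    have hF : fderiv ℝ (fun ξ : M3 => ((ξ.1, θ ξ) : M3)) ξ
        = (ContinuousLinearMap.fst ℝ (ℝ × ℝ) ℝ).prod (fderiv ℝ θ ξ) :=
      (hasFDerivAt_fst.prodMk (hθd ξ hξ).hasFDerivAt).fderiv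
    rw [hF]
    refine Prod.ext ?_ ?_
    · simp
    · have := hne ξ hξ
      simp only [ContinuousLinearMap.prod_apply, map_smul, Prod.smul_snd, smul_eq_mul]
      field_simp

/-- Necessity, geometric part: fibre curves are affinely equivalent to the model curve. -/
lemma aux_nec (F : M3 → ℝ × ℝ) (c₁ c₂ : ℝ → ℝ)
    (hE : EquivToQuadClass (fun ξ => ((F ξ, (0 : ℝ)) : M3))
      (fun _ => (((0 : ℝ × ℝ), (1 : ℝ)) : M3)) 0 c₁ c₂) :
    ∃ r > 0, ∀ x : ℝ × ℝ, ‖x‖ < r → ∃ p₁ q₁ r₁ p₂ q₂ r₂ : ℝ, p₁ * q₂ - p₂ * q₁ ≠ 0 ∧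
      ∀ w : ℝ, |w| < r → ∃ t : ℝ, c₁ t = p₁ * (F (x, w)).1 + q₁ * (F (x, w)).2 + r₁ ∧
        c₂ t = p₂ * (F (x, w)).1 + q₂ * (F (x, w)).2 + r₂ := by
  obtain ⟨A, B, C, V2, -, -, -, -, hLI, Φ, α, β, U, hUo, h0, hΦ, hbij, hΦV, -, -, hβ, hf, hg⟩ := hE
  obtain ⟨r, hr, hball⟩ := Metric.isOpen_iff.1 hUo 0 h0
  have hmem : ∀ (x : ℝ × ℝ) (w : ℝ), ‖x‖ < r → |w| < r → ((x, w) : M3) ∈ U := by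
    intro x w hx hw
    apply hball
    rw [mem_ball_zero_iff]
    exact max_lt hx hw
  have hd : ∀ ξ ∈ U, HasFDerivAt Φ (fderiv ℝ Φ ξ) ξ := fun ξ hξ =>
    ((hΦ.contDiffAt (hUo.mem_nhds hξ)).differentiableAt (by simp)).hasFDerivAt
  have hvert : ∀ ξ ∈ U, fderiv ℝ Φ ξ ((0 : ℝ × ℝ), (1 : ℝ)) = ((0 : ℝ × ℝ), (β ξ)⁻¹) := by
    intro ξ hξ
    have h1 : fderiv ℝ Φ ξ (β ξ • ((0 : ℝ × ℝ), (1 : ℝ))) = ((0 : ℝ × ℝ), (1 : ℝ)) := hg ξ hξ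
    rw [map_smul] at h1
    have h2 : fderiv ℝ Φ ξ ((0 : ℝ × ℝ), (1 : ℝ)) = (β ξ)⁻¹ • ((0 : ℝ × ℝ), (1 : ℝ)) := by
      exact (eq_inv_smul_iff₀ (hβ ξ hξ)).2 h1
    rw [h2]; simp
  have hconst : ∀ (x : ℝ × ℝ) (w : ℝ), ‖x‖ < r → |w| < r → (Φ (x, w)).1 = (Φ (x, 0)).1 := by
    intro x w hx hw
    have hD : ∀ s ∈ Ioo (-r) r, HasDerivAt (fun s : ℝ => (Φ (x, s)).1) 0 s := by
      intro s hs
      have hξ := hmem x s hx (abs_lt.2 hs)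
      have hline : HasDerivAt (fun s : ℝ => ((x, s) : M3)) ((0 : ℝ × ℝ), (1 : ℝ)) s :=
        (hasDerivAt_const s x).prodMk (hasDerivAt_id s)
      have := (hasFDerivAt_fst (𝕜 := ℝ) (p := Φ (x, s))).comp_hasDerivAt s
        ((hd _ hξ).comp_hasDerivAt s hline)
      rw [hvert _ hξ] at this
      exact this
    refine IsOpen.is_const_of_deriv_eq_zero (s := Ioo (-r) r) isOpen_Ioo
      isPreconnected_Ioo (f := fun s : ℝ => (Φ (x, s)).1)
      (fun s hs => (hD s hs).differentiableAt.differentiableWithinAt)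
      (fun s hs => (hD s hs).deriv) (abs_lt.1 hw) ⟨by linarith, hr⟩
  refine ⟨r, hr, fun x hx => ?_⟩
  set L : (ℝ × ℝ) →L[ℝ] ℝ × ℝ := fderiv ℝ (fun x' : ℝ × ℝ => (Φ (x', 0)).1) x with hL
  have hLeq : ∀ w : ℝ, |w| < r → ∀ v : ℝ × ℝ, (fderiv ℝ Φ (x, w) (v, 0)).1 = L v := by
    intro w hw v
    have hξ := hmem x w hx hw
    have hline : HasFDerivAt (fun x' : ℝ × ℝ => ((x', w) : M3))
        ((ContinuousLinearMap.id ℝ (ℝ × ℝ)).prod 0) x :=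
      (hasFDerivAt_id x).prodMk (hasFDerivAt_const w x)
    have h1 : HasFDerivAt (fun x' : ℝ × ℝ => (Φ (x', w)).1) _ x :=
      (hasFDerivAt_fst (𝕜 := ℝ) (p := Φ (x, w))).comp x ((hd _ hξ).comp x hline)
    have h2 : (fun x' : ℝ × ℝ => (Φ (x', 0)).1) =ᶠ[nhds x] fun x' => (Φ (x', w)).1 := by
      have : ∀ᶠ x' in nhds x, ‖x'‖ < r := continuous_norm.continuousAt.eventually
        (gt_mem_nhds hx)
      filter_upwards [this] with x' hx'
      exact (hconst x' w hx' hw).symm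
    have h3 := (h1.congr_of_eventuallyEq h2).fderiv
    rw [hL, h3]
    simp
  have h00 : |(0 : ℝ)| < r := by simpa using hr
  have hLinj : ∀ v, L v = 0 → v = 0 := by
    intro v hv
    have hξ := hmem x 0 hx h00
    rw [← hLeq 0 h00 v] at hv
    have h1 : fderiv ℝ Φ (x, 0) (v, 0) = fderiv ℝ Φ (x, 0)
        ((β (x, 0) * (fderiv ℝ Φ (x, 0) (v, 0)).2) • ((0 : ℝ × ℝ), (1 : ℝ))) := by
      rw [map_smul, hvert _ hξ]
      have := hβ _ hξ
      refine Prod.ext ?_ ?_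
      · simpa using hv
      · simp only [Prod.smul_snd, smul_eq_mul]
        field_simp
    have h2 := (hbij _ hξ).1 h1
    simpa using congrArg Prod.fst h2
  have hdet : (L (1, 0)).1 * (L (0, 1)).2 - (L (1, 0)).2 * (L (0, 1)).1 ≠ 0 := by
    rw [← aux_LI, LinearIndependent.pair_iff]
    intro s t hst
    have : L (s, t) = 0 := by
      rw [← hst, ← map_smul, ← map_smul, ← map_add]
      simp
    have := hLinj _ this
    exact ⟨congrArg Prod.fst this, congrArg Prod.snd this⟩
  set y := (Φ (x, 0)).1 with hy
  have hyV : y ∈ V2 := (hΦV _ (hmem x 0 hx h00)).1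
  have hAB := (aux_LI _ _).1 (hLI y hyV)
  set Δ := (A y).1 * (B y).2 - (A y).2 * (B y).1 with hΔ
  set l₁ := L (1, 0)
  set l₂ := L (0, 1)
  refine ⟨(l₁.1 * (B y).2 - l₁.2 * (B y).1) / Δ, (l₂.1 * (B y).2 - l₂.2 * (B y).1) / Δ,
    -((C y).1 * (B y).2 - (C y).2 * (B y).1) / Δ,
    ((A y).1 * l₁.2 - (A y).2 * l₁.1) / Δ, ((A y).1 * l₂.2 - (A y).2 * l₂.1) / Δ,
    -((A y).1 * (C y).2 - (A y).2 * (C y).1) / Δ, ?_, ?_⟩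
  · have : (l₁.1 * (B y).2 - l₁.2 * (B y).1) / Δ * (((A y).1 * l₂.2 - (A y).2 * l₂.1) / Δ)
      - ((A y).1 * l₁.2 - (A y).2 * l₁.1) / Δ * ((l₂.1 * (B y).2 - l₂.2 * (B y).1) / Δ)
      = (l₁.1 * l₂.2 - l₁.2 * l₂.1) / Δ := by
      field_simp
      rw [hΔ]; ring
    rw [this]
    exact div_ne_zero hdet hAB
  · intro w hw
    refine ⟨(Φ (x, w)).2, ?_⟩
    have hξ := hmem x w hx hw
    have h1 := congrArg Prod.fst (hf _ hξ)
    rw [map_add, map_smul, hvert _ hξ] at h1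
    have hy2 : (Φ (x, w)).1 = y := hconst x w hx hw
    simp only [Prod.fst_add, Prod.smul_fst, smul_zero, add_zero, hy2] at h1
    rw [hLeq w hw] at h1
    have hdec : L (F (x, w)) = (F (x, w)).1 • l₁ + (F (x, w)).2 • l₂ := by
      rw [← map_smul, ← map_smul, ← map_add]
      simp
    rw [hdec] at h1
    have e1 := congrArg Prod.fst h1
    have e2 := congrArg Prod.snd h1
    simp only [Prod.fst_add, Prod.snd_add, Prod.smul_fst, Prod.smul_snd, smul_eq_mul] at e1 e2
    constructor
    · field_simp
      rw [hΔ]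
      linear_combination (-(B y).2) * e1 + (B y).1 * e2
    · field_simp
      rw [hΔ]
      linear_combination (-(A y).1) * e2 + (A y).2 * e1

lemma aux_conic (d e w : ℝ) (hp : 0 ≤ d * w ^ 2 + e * w + 1)
    (hD : 1 + e * w / 2 + Real.sqrt (d * w ^ 2 + e * w + 1) ≠ 0) :
    (Real.sqrt (d * w ^ 2 + e * w + 1) + 1) ^ 2 - d * w ^ 2
      = 2 * (1 + e * w / 2 + Real.sqrt (d * w ^ 2 + e * w + 1)) ∧
    (e ^ 2 / 4 - d) * (w ^ 2 / (1 + e * w / 2 + Real.sqrt (d * w ^ 2 + e * w + 1))) ^ 2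
      - e * (w ^ 2 / (1 + e * w / 2 + Real.sqrt (d * w ^ 2 + e * w + 1))) * w + w ^ 2
      - 2 * (w ^ 2 / (1 + e * w / 2 + Real.sqrt (d * w ^ 2 + e * w + 1))) = 0 := by
  have hq := Real.sq_sqrt hp
  generalize Real.sqrt (d * w ^ 2 + e * w + 1) = q at *
  refine ⟨by linear_combination hq, ?_⟩
  generalize hDD : 1 + e * w / 2 + q = D at *
  have : (e ^ 2 / 4 - d) * (w ^ 2 / D) ^ 2 - e * (w ^ 2 / D) * w + w ^ 2 - 2 * (w ^ 2 / D)
      = w ^ 2 * ((e ^ 2 / 4 - d) * w ^ 2 - e * w * D + D ^ 2 - 2 * D) / D ^ 2 := by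
    field_simp
  rw [this, ← hDD]
  have h0 : (e ^ 2 / 4 - d) * w ^ 2 - e * w * (1 + e * w / 2 + q) + (1 + e * w / 2 + q) ^ 2
      - 2 * (1 + e * w / 2 + q) = 0 := by linear_combination hq
  rw [h0]
  simp

lemma aux_nec2 (a b c d e : (ℝ × ℝ) → ℝ) (ε : ℝ) (c₁ c₂ : ℝ → ℝ)
    (hE : EquivToQuadClass
        (fun ξ : M3 =>
          (((2 * a ξ.1 * ξ.2 ^ 2
              / ((Real.sqrt (d ξ.1 * ξ.2 ^ 2 + e ξ.1 * ξ.2 + 1) + 1) ^ 2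
                  - d ξ.1 * ξ.2 ^ 2)
            + b ξ.1 * ξ.2 + c ξ.1, ξ.2 + ε), (0 : ℝ)) : M3))
        (fun _ => (((0 : ℝ × ℝ), (1 : ℝ)) : M3)) (0 : M3) c₁ c₂) :
    ∃ r > 0, ∀ x : ℝ × ℝ, ‖x‖ < r → a x ≠ 0 → ∃ (H : ℝ → ℝ) (p₁ q₁ r₁ p₂ q₂ r₂ : ℝ),
      p₁ * q₂ - p₂ * q₁ ≠ 0 ∧
      (∀ᶠ w in nhds (0 : ℝ),
        (e x ^ 2 / 4 - d x) * H w ^ 2 - e x * H w * w + w ^ 2 - 2 * H w = 0) ∧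
      ∀ᶠ w in nhds (0 : ℝ), ∃ t : ℝ, c₁ t = p₁ * H w + q₁ * w + r₁ ∧
        c₂ t = p₂ * H w + q₂ * w + r₂ := by
  obtain ⟨r, hr, hall⟩ := aux_nec _ c₁ c₂ hE
  refine ⟨r, hr, fun x hx hax => ?_⟩
  obtain ⟨p₁, q₁, r₁, p₂, q₂, r₂, hdet, hw⟩ := hall x hx
  have hp : ∀ᶠ w in nhds (0 : ℝ), 0 < d x * w ^ 2 + e x * w + 1 := by
    have : ContinuousAt (fun w : ℝ => d x * w ^ 2 + e x * w + 1) 0 := by fun_prop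
    exact this.eventually (lt_mem_nhds (by simp))
  have hD : ∀ᶠ w in nhds (0 : ℝ),
      0 < 1 + e x * w / 2 + Real.sqrt (d x * w ^ 2 + e x * w + 1) := by
    have : ContinuousAt
      (fun w : ℝ => 1 + e x * w / 2 + Real.sqrt (d x * w ^ 2 + e x * w + 1)) 0 := by fun_prop
    exact this.eventually (lt_mem_nhds (by norm_num))
  have hr' : ∀ᶠ w in nhds (0 : ℝ), |w| < r := by
    have : ContinuousAt (fun w : ℝ => |w|) 0 := by fun_prop
    exact this.eventually (gt_mem_nhds (by simpa using hr))
  refine ⟨fun w => w ^ 2 / (1 + e x * w / 2 + Real.sqrt (d x * w ^ 2 + e x * w + 1)),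
    p₁ * a x, p₁ * b x + q₁, p₁ * c x + q₁ * ε + r₁,
    p₂ * a x, p₂ * b x + q₂, p₂ * c x + q₂ * ε + r₂, ?_, ?_, ?_⟩
  · have : p₁ * a x * (p₂ * b x + q₂) - p₂ * a x * (p₁ * b x + q₁)
        = a x * (p₁ * q₂ - p₂ * q₁) := by ring
    rw [this]
    exact mul_ne_zero hax hdet
  · filter_upwards [hp, hD] with w h1 h2
    exact (aux_conic _ _ _ h1.le h2.ne').2
  · filter_upwards [hp, hD, hr'] with w h1 h2 h3
    obtain ⟨t, ht1, ht2⟩ := hw w h3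
    have hc := (aux_conic _ _ _ h1.le h2.ne').1
    simp only [hc] at ht1 ht2
    have h4 := h2.ne'
    have h5 : 2 * a x * w ^ 2 / (2 * (1 + e x * w / 2 + Real.sqrt (d x * w ^ 2 + e x * w + 1)))
      = a x * (w ^ 2 / (1 + e x * w / 2 + Real.sqrt (d x * w ^ 2 + e x * w + 1))) := by
      rw [mul_assoc, mul_div_mul_left _ _ two_ne_zero, mul_div_assoc]
    rw [h5] at ht1 ht2
    refine ⟨t, ?_, ?_⟩
    · rw [ht1]; ring
    · rw [ht2]; ring

lemma aux_suff2 (a b c d e : (ℝ × ℝ) → ℝ) (ε : ℝ)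
    (ha : ContDiff ℝ (⊤ : ℕ∞) a) (hb : ContDiff ℝ (⊤ : ℕ∞) b) (hc : ContDiff ℝ (⊤ : ℕ∞) c)
    (hd : ContDiff ℝ (⊤ : ℕ∞) d) (he : ContDiff ℝ (⊤ : ℕ∞) e)
    (c₁ c₂ : ℝ → ℝ) (hc₁ : Differentiable ℝ c₁)
    (hc₂ : Differentiable ℝ c₂) (V2 : Set (ℝ × ℝ)) (hV : IsOpen V2) (h0 : (0 : ℝ × ℝ) ∈ V2)
    (haV : ∀ x ∈ V2, a x ≠ 0)
    (G : (ℝ × ℝ) × ℝ → ℝ) (l s : (ℝ × ℝ) → ℝ)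
    (hl : ContDiffOn ℝ (⊤ : ℕ∞) l V2) (hs : ContDiffOn ℝ (⊤ : ℕ∞) s V2)
    (hl0 : ∀ x ∈ V2, l x ≠ 0) (hs0 : ∀ x ∈ V2, s x ≠ 0) (κ : ℝ)
    (hG : ∀ x ∈ V2, ∀ u H : ℝ, 0 < 1 + d x * H → u ^ 2 - d x * H ^ 2 - 2 * H = 0 →
      ContDiffAt ℝ (⊤ : ℕ∞) G (x, u) ∧ H = l x * (c₁ (G (x, u)) - κ) ∧ u = s x * c₂ (G (x, u))) :
    EquivToQuadClass
        (fun ξ : M3 =>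
          (((2 * a ξ.1 * ξ.2 ^ 2
              / ((Real.sqrt (d ξ.1 * ξ.2 ^ 2 + e ξ.1 * ξ.2 + 1) + 1) ^ 2
                  - d ξ.1 * ξ.2 ^ 2)
            + b ξ.1 * ξ.2 + c ξ.1, ξ.2 + ε), (0 : ℝ)) : M3))
        (fun _ => (((0 : ℝ × ℝ), (1 : ℝ)) : M3)) (0 : M3) c₁ c₂ := by
  let H : M3 → ℝ := fun ξ => ξ.2 ^ 2 / (1 + e ξ.1 * ξ.2 / 2
    + Real.sqrt (d ξ.1 * ξ.2 ^ 2 + e ξ.1 * ξ.2 + 1))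
  have hac := ha.continuous
  have hdc := hd.continuous
  have hec := he.continuous
  have hp : ∀ᶠ ξ in nhds (0 : M3), 0 < d ξ.1 * ξ.2 ^ 2 + e ξ.1 * ξ.2 + 1 := by
    have : Continuous (fun ξ : M3 => d ξ.1 * ξ.2 ^ 2 + e ξ.1 * ξ.2 + 1) := by fun_prop
    exact this.continuousAt.eventually (lt_mem_nhds (by simp))
  have hDc : Continuous
      (fun ξ : M3 => 1 + e ξ.1 * ξ.2 / 2
        + Real.sqrt (d ξ.1 * ξ.2 ^ 2 + e ξ.1 * ξ.2 + 1)) := by fun_prop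
  have hD : ∀ᶠ ξ in nhds (0 : M3),
      0 < 1 + e ξ.1 * ξ.2 / 2 + Real.sqrt (d ξ.1 * ξ.2 ^ 2 + e ξ.1 * ξ.2 + 1) :=
    hDc.continuousAt.eventually (lt_mem_nhds (by norm_num))
  have hHc : ContinuousAt H 0 :=
    ContinuousAt.div (by fun_prop) hDc.continuousAt hD.self_of_nhds.ne'
  have hH1 : ∀ᶠ ξ in nhds (0 : M3), 0 < 1 + d ξ.1 * H ξ := by
    have : ContinuousAt (fun ξ : M3 => 1 + d ξ.1 * H ξ) 0 := by fun_prop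
    exact this.eventually (lt_mem_nhds (by simp [H]))
  have hV0 : ∀ᶠ ξ in nhds (0 : M3), ξ.1 ∈ V2 :=
    continuous_fst.continuousAt.eventually (hV.mem_nhds h0)
  refine aux_suff _ (fun ξ => G (ξ.1, ξ.2 - e ξ.1 / 2 * H ξ)) ε c₁ c₂ hc₁ hc₂
    (fun x => (l x * (a x + b x * e x / 2), l x * (e x / 2)))
    (fun x => (s x * b x, s x))
    (fun x => (c x - κ * (l x * (a x + b x * e x / 2)), ε - κ * (l x * (e x / 2)))) V2 hV
    ?_ ?_ ?_ ?_ ?_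
  · exact (hl.mul (ha.add ((hb.mul he).div_const 2)).contDiffOn).prodMk
      (hl.mul (he.div_const 2).contDiffOn)
  · exact (hs.mul hb.contDiffOn).prodMk hs
  · exact (hc.contDiffOn.sub (contDiffOn_const.mul
      (hl.mul (ha.add ((hb.mul he).div_const 2)).contDiffOn))).prodMk
      (contDiffOn_const.sub (contDiffOn_const.mul (hl.mul (he.div_const 2).contDiffOn)))
  · intro x hx
    have : l x * (a x + b x * e x / 2) * s x - l x * (e x / 2) * (s x * b x)
      = l x * s x * a x := by ring
    simp only [this]
    exact mul_ne_zero (mul_ne_zero (hl0 x hx) (hs0 x hx)) (haV x hx)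
  · filter_upwards [hp, hD, hH1, hV0] with ξ h1 h2 h3 h4
    have hco := aux_conic _ _ _ h1.le h2.ne'
    have hu : (ξ.2 - e ξ.1 / 2 * H ξ) ^ 2 - d ξ.1 * H ξ ^ 2 - 2 * H ξ = 0 := by
      have := hco.2
      change (e ξ.1 ^ 2 / 4 - d ξ.1) * H ξ ^ 2 - e ξ.1 * H ξ * ξ.2 + ξ.2 ^ 2 - 2 * H ξ = 0 at this
      linear_combination this
    obtain ⟨g1, g2, g3⟩ := hG ξ.1 h4 _ _ h3 hu
    have sa : ContDiffAt ℝ (⊤ : ℕ∞) (fun ξ : M3 => a ξ.1) ξ := (ha.comp contDiff_fst).contDiffAt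
    have sb : ContDiffAt ℝ (⊤ : ℕ∞) (fun ξ : M3 => b ξ.1) ξ := (hb.comp contDiff_fst).contDiffAt
    have sc : ContDiffAt ℝ (⊤ : ℕ∞) (fun ξ : M3 => c ξ.1) ξ := (hc.comp contDiff_fst).contDiffAt
    have sd : ContDiffAt ℝ (⊤ : ℕ∞) (fun ξ : M3 => d ξ.1) ξ := (hd.comp contDiff_fst).contDiffAt
    have se : ContDiffAt ℝ (⊤ : ℕ∞) (fun ξ : M3 => e ξ.1) ξ := (he.comp contDiff_fst).contDiffAt
    have sw : ContDiffAt ℝ (⊤ : ℕ∞) (fun ξ : M3 => ξ.2) ξ := contDiff_snd.contDiffAt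
    have s1 : ContDiffAt ℝ (⊤ : ℕ∞)
        (fun ξ : M3 => Real.sqrt (d ξ.1 * ξ.2 ^ 2 + e ξ.1 * ξ.2 + 1)) ξ :=
      ContDiffAt.sqrt (((sd.mul (sw.pow 2)).add (se.mul sw)).add contDiffAt_const) h1.ne'
    have sH : ContDiffAt ℝ (⊤ : ℕ∞) H ξ :=
      (sw.pow 2).div ((contDiffAt_const.add ((se.mul sw).div_const 2)).add s1) h2.ne'
    have hden : (Real.sqrt (d ξ.1 * ξ.2 ^ 2 + e ξ.1 * ξ.2 + 1) + 1) ^ 2 - d ξ.1 * ξ.2 ^ 2 ≠ 0 := by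
      rw [hco.1]; positivity
    refine ⟨?_, ?_, h4, ?_⟩
    · exact ((((contDiffAt_const.mul sa).mul (sw.pow 2)).div
        (((s1.add contDiffAt_const).pow 2).sub (sd.mul (sw.pow 2))) hden).add
          (sb.mul sw)).add sc
    · have s2 : ContDiffAt ℝ (⊤ : ℕ∞)
          (fun ξ : M3 => ((ξ.1, ξ.2 - e ξ.1 / 2 * H ξ) : (ℝ × ℝ) × ℝ)) ξ :=
        contDiff_fst.contDiffAt.prodMk (sw.sub ((se.div_const 2).mul sH))
      exact ContDiffAt.comp ξ g1 s2
    · have h5 : 2 * a ξ.1 * ξ.2 ^ 2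
          / ((Real.sqrt (d ξ.1 * ξ.2 ^ 2 + e ξ.1 * ξ.2 + 1) + 1) ^ 2 - d ξ.1 * ξ.2 ^ 2)
          = a ξ.1 * H ξ := by
        rw [hco.1, mul_assoc, mul_div_mul_left _ _ two_ne_zero, mul_div_assoc]
      rw [h5]
      generalize c₁ (G (ξ.1, ξ.2 - e ξ.1 / 2 * H ξ)) = k₁ at *
      generalize c₂ (G (ξ.1, ξ.2 - e ξ.1 / 2 * H ξ)) = k₂ at *
      generalize H ξ = η at *
      refine Prod.ext ?_ ?_
      · simp only [Prod.fst_add, Prod.smul_fst, smul_eq_mul]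
        linear_combination b ξ.1 * g3 + (a ξ.1 + b ξ.1 * e ξ.1 / 2) * g2
      · simp only [Prod.snd_add, Prod.smul_snd, smul_eq_mul]
        linear_combination g3 + (e ξ.1 / 2) * g2

/-- the system `Σ_h : ż = h(z,y,w), ẏ = w + ε, ẇ = u` with
`h = 2aw²/((√p+1)² − dw²) + bw + c`, `p = dw² + ew + 1`, `a(0) ≠ 0`, `ε ∈ {0,1}`, is
locally feedback equivalent at `0` to a parabolic system iff `d ≡ 0` near `0 ∈ ℝ²`, to an
elliptic system iff `d(0) < 0`, and to a hyperbolic system iff `d(0) > 0`. -/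
theorem stmt_10 (a b c d e : (ℝ × ℝ) → ℝ) (ε : ℝ)
    (ha : ContDiff ℝ (⊤ : ℕ∞) a) (hb : ContDiff ℝ (⊤ : ℕ∞) b) (hc : ContDiff ℝ (⊤ : ℕ∞) c)
    (hd : ContDiff ℝ (⊤ : ℕ∞) d) (he : ContDiff ℝ (⊤ : ℕ∞) e)
    (ha0 : a 0 ≠ 0) (hε : ε = 0 ∨ ε = 1) :
    ((EquivToQuadClass
        (fun ξ : M3 =>
          (((2 * a ξ.1 * ξ.2 ^ 2
              / ((Real.sqrt (d ξ.1 * ξ.2 ^ 2 + e ξ.1 * ξ.2 + 1) + 1) ^ 2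
                  - d ξ.1 * ξ.2 ^ 2)
            + b ξ.1 * ξ.2 + c ξ.1, ξ.2 + ε), (0 : ℝ)) : M3))
        (fun _ => (((0 : ℝ × ℝ), (1 : ℝ)) : M3))
        (0 : M3) (fun w => w ^ 2) (fun w => w))
      ↔ ∃ U2 : Set (ℝ × ℝ), IsOpen U2 ∧ (0 : ℝ × ℝ) ∈ U2 ∧ ∀ x ∈ U2, d x = 0) ∧
    ((EquivToQuadClass
        (fun ξ : M3 =>
          (((2 * a ξ.1 * ξ.2 ^ 2
              / ((Real.sqrt (d ξ.1 * ξ.2 ^ 2 + e ξ.1 * ξ.2 + 1) + 1) ^ 2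
                  - d ξ.1 * ξ.2 ^ 2)
            + b ξ.1 * ξ.2 + c ξ.1, ξ.2 + ε), (0 : ℝ)) : M3))
        (fun _ => (((0 : ℝ × ℝ), (1 : ℝ)) : M3))
        (0 : M3) Real.cos Real.sin)
      ↔ d 0 < 0) ∧
    ((EquivToQuadClass
        (fun ξ : M3 =>
          (((2 * a ξ.1 * ξ.2 ^ 2
              / ((Real.sqrt (d ξ.1 * ξ.2 ^ 2 + e ξ.1 * ξ.2 + 1) + 1) ^ 2
                  - d ξ.1 * ξ.2 ^ 2)
            + b ξ.1 * ξ.2 + c ξ.1, ξ.2 + ε), (0 : ℝ)) : M3))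
        (fun _ => (((0 : ℝ × ℝ), (1 : ℝ)) : M3))
        (0 : M3) Real.cosh Real.sinh)
      ↔ 0 < d 0) := by
  have hane : IsOpen {x | a x ≠ 0} := isOpen_ne_fun ha.continuous continuous_const
  refine ⟨⟨?_, ?_⟩, ⟨?_, ?_⟩, ⟨?_, ?_⟩⟩
  · intro hE
    obtain ⟨r, hr, hall⟩ := aux_nec2 a b c d e ε _ _ hE
    refine ⟨Metric.ball 0 r ∩ {x | a x ≠ 0}, Metric.isOpen_ball.inter hane,
      ⟨Metric.mem_ball_self hr, ha0⟩, ?_⟩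
    rintro x ⟨hx, hax⟩
    obtain ⟨H, p₁, q₁, r₁, p₂, q₂, r₂, hdet, hH, hw⟩ := hall x (mem_ball_zero_iff.1 hx) hax
    obtain ⟨h1, h2, h3⟩ := aux_rigid _ _ H (-p₂ ^ 2) (-2 * p₂ * q₂) (-q₂ ^ 2) (p₁ - 2 * p₂ * r₂)
      (q₁ - 2 * q₂ * r₂) (r₁ - r₂ ^ 2) hH (by
        filter_upwards [hw] with w hw
        obtain ⟨t, e1, e2⟩ := hw
        rw [e2] at e1
        linear_combination -e1)
    have hq : q₂ ≠ 0 := by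
      intro hq
      subst hq
      have hp2 : p₂ = 0 := by
        have : p₂ ^ 2 = 0 := by linarith
        simpa using this
      subst hp2
      have hp1 : p₁ = 0 := by linarith
      subst hp1
      simp at hdet
    have : d x * q₂ ^ 4 = 0 := by
      linear_combination -(e x * q₂ ^ 2 - 2 * p₂ * q₂) / 4 * h2 - q₂ ^ 2 * h3
    exact (mul_eq_zero.1 this).resolve_right (pow_ne_zero 4 hq)
  · rintro ⟨U2, hU, hU0, hdU⟩
    refine aux_suff2 a b c d e ε ha hb hc hd he _ _ (by fun_prop) (by fun_prop)
      (U2 ∩ {x | a x ≠ 0}) (hU.inter hane) ⟨hU0, ha0⟩ (fun x hx => hx.2)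
      (fun ξ => ξ.2) (fun _ => 1 / 2) (fun _ => 1) contDiffOn_const contDiffOn_const
      (fun _ _ => by norm_num) (fun _ _ => by norm_num) 0 ?_
    intro x hx u H _ h2
    rw [hdU x hx.1] at h2
    exact ⟨contDiffAt_snd, by linarith, by simp⟩
  · intro hE
    obtain ⟨r, hr, hall⟩ := aux_nec2 a b c d e ε _ _ hE
    obtain ⟨H, p₁, q₁, r₁, p₂, q₂, r₂, hdet, hH, hw⟩ := hall 0 (by simpa using hr) ha0
    obtain ⟨h1, h2, h3⟩ := aux_rigid _ _ H (p₁ ^ 2 + p₂ ^ 2) (2 * (p₁ * q₁ + p₂ * q₂))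
      (q₁ ^ 2 + q₂ ^ 2) (2 * (p₁ * r₁ + p₂ * r₂)) (2 * (q₁ * r₁ + q₂ * r₂))
      (r₁ ^ 2 + r₂ ^ 2 - 1) hH (by
        filter_upwards [hw] with w hw
        obtain ⟨t, e1, e2⟩ := hw
        have := Real.cos_sq_add_sin_sq t
        rw [e1, e2] at this
        linear_combination this)
    have h4 : d 0 * (q₁ ^ 2 + q₂ ^ 2) ^ 2 = -(p₁ * q₂ - p₂ * q₁) ^ 2 := by
      linear_combination ((-(2 * (p₁ * q₁ + p₂ * q₂)) + e 0 * (q₁ ^ 2 + q₂ ^ 2)) / 4) * h2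
        + (q₁ ^ 2 + q₂ ^ 2) * h3
    have h5 : 0 < (p₁ * q₂ - p₂ * q₁) ^ 2 := by positivity
    by_contra hcon
    have h6 : 0 ≤ d 0 * (q₁ ^ 2 + q₂ ^ 2) ^ 2 := mul_nonneg (not_lt.1 hcon) (sq_nonneg _)
    linarith
  · intro hd0
    have hsq : ContDiffOn ℝ (⊤ : ℕ∞) (fun x => Real.sqrt (-d x)) ({x | d x < 0} ∩ {x | a x ≠ 0}) :=
      fun x hx => (ContDiffAt.sqrt hd.neg.contDiffAt (by have : d x < 0 := hx.1; linarith)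
        ).contDiffWithinAt
    have hsp : ∀ x, d x < 0 → 0 < Real.sqrt (-d x) := fun x hx => Real.sqrt_pos.2 (by linarith)
    refine aux_suff2 a b c d e ε ha hb hc hd he _ _ Real.differentiable_cos Real.differentiable_sin
      ({x | d x < 0} ∩ {x | a x ≠ 0})
      ((isOpen_lt hd.continuous continuous_const).inter hane) ⟨hd0, ha0⟩ (fun x hx => hx.2)
      (fun ξ => Real.arcsin (Real.sqrt (-d ξ.1) * ξ.2)) (fun x => (d x)⁻¹)
      (fun x => (Real.sqrt (-d x))⁻¹) (hd.contDiffOn.inv fun x hx => ne_of_lt hx.1)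
      (hsq.inv fun x hx => (hsp x hx.1).ne')
      (fun x hx => inv_ne_zero (ne_of_lt hx.1)) (fun x hx => inv_ne_zero (hsp x hx.1).ne') 1 ?_
    rintro x ⟨hx, hax⟩ u H h1 h2
    have hx' : d x < 0 := hx
    have hxne : d x ≠ 0 := hx'.ne
    have hs := hsp x hx
    have hs2 : Real.sqrt (-d x) ^ 2 = -d x := Real.sq_sqrt (by linarith)
    have h3 : 1 - (Real.sqrt (-d x) * u) ^ 2 = (1 + d x * H) ^ 2 := by
      rw [mul_pow, hs2]
      linear_combination (d x) * h2
    have h4 : |Real.sqrt (-d x) * u| < 1 := by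
      rw [← sq_lt_one_iff_abs_lt_one]
      have : 0 < (1 + d x * H) ^ 2 := by positivity
      linarith
    have h5 := abs_lt.1 h4
    refine ⟨?_, ?_, ?_⟩
    · have e1 : ContDiffAt ℝ (⊤ : ℕ∞) (fun ξ : M3 => Real.sqrt (-d ξ.1) * ξ.2) (x, u) :=
        (ContDiffAt.sqrt (hd.comp contDiff_fst).neg.contDiffAt (by simp; linarith)).mul
          contDiffAt_snd
      exact ContDiffAt.comp (g := Real.arcsin) (x, u) (Real.contDiffAt_arcsin (by simpa using h5.1.ne')
        (by simpa using h5.2.ne)) e1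
    · simp only [Real.cos_arcsin]
      rw [h3, Real.sqrt_sq h1.le]
      field_simp
      ring
    · simp only [Real.sin_arcsin h5.1.le h5.2.le]
      field_simp
  · intro hE
    obtain ⟨r, hr, hall⟩ := aux_nec2 a b c d e ε _ _ hE
    obtain ⟨H, p₁, q₁, r₁, p₂, q₂, r₂, hdet, hH, hw⟩ := hall 0 (by simpa using hr) ha0
    obtain ⟨h1, h2, h3⟩ := aux_rigid _ _ H (p₁ ^ 2 - p₂ ^ 2) (2 * (p₁ * q₁ - p₂ * q₂))
      (q₁ ^ 2 - q₂ ^ 2) (2 * (p₁ * r₁ - p₂ * r₂)) (2 * (q₁ * r₁ - q₂ * r₂))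
      (r₁ ^ 2 - r₂ ^ 2 - 1) hH (by
        filter_upwards [hw] with w hw
        obtain ⟨t, e1, e2⟩ := hw
        have := Real.cosh_sq_sub_sinh_sq t
        rw [e1, e2] at this
        linear_combination this)
    have h4 : d 0 * (q₁ ^ 2 - q₂ ^ 2) ^ 2 = (p₁ * q₂ - p₂ * q₁) ^ 2 := by
      linear_combination ((-(2 * (p₁ * q₁ - p₂ * q₂)) + e 0 * (q₁ ^ 2 - q₂ ^ 2)) / 4) * h2
        + (q₁ ^ 2 - q₂ ^ 2) * h3
    have h5 : 0 < (p₁ * q₂ - p₂ * q₁) ^ 2 := by positivity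
    by_contra hcon
    have h6 : d 0 * (q₁ ^ 2 - q₂ ^ 2) ^ 2 ≤ 0 :=
      mul_nonpos_of_nonpos_of_nonneg (not_lt.1 hcon) (sq_nonneg _)
    linarith
  · intro hd0
    have hsq : ContDiffOn ℝ (⊤ : ℕ∞) (fun x => Real.sqrt (d x)) ({x | 0 < d x} ∩ {x | a x ≠ 0}) :=
      fun x hx => (ContDiffAt.sqrt hd.contDiffAt (ne_of_gt hx.1)).contDiffWithinAt
    have hsp : ∀ x, 0 < d x → 0 < Real.sqrt (d x) := fun x hx => Real.sqrt_pos.2 hx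
    refine aux_suff2 a b c d e ε ha hb hc hd he _ _ Real.differentiable_cosh
      Real.differentiable_sinh
      ({x | 0 < d x} ∩ {x | a x ≠ 0})
      ((isOpen_lt continuous_const hd.continuous).inter hane) ⟨hd0, ha0⟩ (fun x hx => hx.2)
      (fun ξ => Real.arsinh (Real.sqrt (d ξ.1) * ξ.2)) (fun x => (d x)⁻¹)
      (fun x => (Real.sqrt (d x))⁻¹) (hd.contDiffOn.inv fun x hx => ne_of_gt hx.1)
      (hsq.inv fun x hx => (hsp x hx.1).ne')
      (fun x hx => inv_ne_zero (ne_of_gt hx.1)) (fun x hx => inv_ne_zero (hsp x hx.1).ne') 1 ?_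
    rintro x ⟨hx, hax⟩ u H h1 h2
    have hx' : 0 < d x := hx
    have hs := hsp x hx
    have hs2 : Real.sqrt (d x) ^ 2 = d x := Real.sq_sqrt hx'.le
    have h3 : 1 + (Real.sqrt (d x) * u) ^ 2 = (1 + d x * H) ^ 2 := by
      rw [mul_pow, hs2]
      linear_combination (d x) * h2
    refine ⟨?_, ?_, ?_⟩
    · have e1 : ContDiffAt ℝ (⊤ : ℕ∞) (fun ξ : M3 => Real.sqrt (d ξ.1) * ξ.2) (x, u) :=
        (ContDiffAt.sqrt (f := fun ξ : M3 => d ξ.1) (x := (x, u))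
          (hd.comp contDiff_fst).contDiffAt (ne_of_gt hx')).mul
          contDiffAt_snd
      exact e1.arsinh
    · simp only [Real.cosh_arsinh]
      rw [h3, Real.sqrt_sq h1.le]
      field_simp
      ring
    · simp only [Real.sinh_arsinh]
      field_simp
end
end

section
/- Let Ξ_E: ẋ = A(x)cos w + B(x)sin w + C(x) and Ξ~_E: ẋ~ = A~(x~)cos w~ + B~(x~)sin w~ + C~(x~) be two elliptic systems (A, B, C and A~, B~, C~ smooth vector fields on open subsets of ℝ² with A∧B ≠ 0 and A~∧B~ ≠ 0). Then Ξ_E and Ξ~_E are locally feedback equivalent via a local diffeomorphism x~ = φ(x) and a reparametrisation w = ψ(x,w~) if and only if ψ(x,w~) = ε·w~ + α(x) with ε ∈ {1,−1} and α smooth, and A~ = φ∗(A cos α + B sin α), B~ = ε·φ∗(−A sin α + B cos α), C~ = φ∗(C). -/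
noncomputable section

open Set

lemma aux_span (a b v : ℝ × ℝ) (h : LinearIndependent ℝ ![a, b]) :
    ∃ p q : ℝ, v = p • a + q • b := by
  rw [LinearIndependent.pair_iff] at h
  have hd : a.1 * b.2 - a.2 * b.1 ≠ 0 := by
    intro hd
    have h1 := h b.1 (-a.1) (by
      ext
      · simp; ring
      · simp; linarith)
    have h2 := h b.2 (-a.2) (by
      ext
      · simp; linarith
      · simp; ring)
    have h3 := h 1 0 (by
      ext
      · simp; linarith [h1.2]
      · simp; linarith [h2.2])
    exact one_ne_zero h3.1
  refine ⟨(v.1 * b.2 - v.2 * b.1) / (a.1 * b.2 - a.2 * b.1),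
    (a.1 * v.2 - a.2 * v.1) / (a.1 * b.2 - a.2 * b.1), ?_⟩
  ext
  · simp only [Prod.fst_add, Prod.smul_fst, smul_eq_mul]
    rw [div_mul_eq_mul_div, div_mul_eq_mul_div, ← add_div, eq_div_iff hd]
    ring
  · simp only [Prod.snd_add, Prod.smul_snd, smul_eq_mul]
    rw [div_mul_eq_mul_div, div_mul_eq_mul_div, ← add_div, eq_div_iff hd]
    ring

lemma aux_alg (p q r s t u : ℝ)
    (h : ∀ w : ℝ, (p * Real.cos w + q * Real.sin w + r) ^ 2
      + (s * Real.cos w + t * Real.sin w + u) ^ 2 = 1)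
    (hd : p * t - q * s ≠ 0) :
    r = 0 ∧ u = 0 ∧ ((q = -s ∧ t = p) ∨ (q = s ∧ t = -p)) := by
  have h0 := h 0
  have h1 := h Real.pi
  have h2 := h (Real.pi / 2)
  have h3 := h (-(Real.pi / 2))
  have h4 := h (Real.pi / 4)
  simp only [Real.cos_zero, Real.sin_zero, Real.cos_pi, Real.sin_pi, Real.cos_pi_div_two,
    Real.sin_pi_div_two, Real.cos_neg, Real.sin_neg, Real.cos_pi_div_four,
    Real.sin_pi_div_four] at h0 h1 h2 h3 h4
  have e1 : p * r + s * u = 0 := by linarith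
  have e2 : q * r + t * u = 0 := by linarith
  have hr : r = 0 := by
    apply (mul_eq_zero.1 (_ : (p * t - q * s) * r = 0)).resolve_left hd
    linear_combination t * e1 - s * e2
  have hu : u = 0 := by
    apply (mul_eq_zero.1 (_ : (p * t - q * s) * u = 0)).resolve_left hd
    linear_combination p * e2 - q * e1
  subst hr hu
  have e3 : p ^ 2 + s ^ 2 = 1 := by linarith
  have e4 : q ^ 2 + t ^ 2 = 1 := by linarith
  have hs : Real.sqrt 2 ^ 2 = 2 := Real.sq_sqrt (by norm_num)
  have e5 : p * q + s * t = 0 := by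
    linear_combination h4 - e3 / 2 - e4 / 2
      - ((p + q) ^ 2 + (s + t) ^ 2) / 4 * hs
  refine ⟨rfl, rfl, ?_⟩
  have e6 : (p * t - q * s - 1) * (p * t - q * s + 1) = 0 := by
    linear_combination e3 * (q ^ 2 + t ^ 2) + e4 - (p * q + s * t) * e5
  rcases mul_eq_zero.1 e6 with e | e
  · left
    constructor
    · linear_combination (-q) * e3 + p * e5 - s * e
    · linear_combination (-t) * e3 + s * e5 + p * e
  · right
    constructor
    · linear_combination (-q) * e3 + p * e5 - s * e
    · linear_combination (-t) * e3 + s * e5 + p * e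

lemma aux_lift (f : ℝ → ℝ) (hf : Differentiable ℝ f) (ε : ℝ)
    (hc : ∀ w, Real.cos (f w) = Real.cos (ε * w + f 0))
    (hs : ∀ w, Real.sin (f w) = Real.sin (ε * w + f 0)) (w : ℝ) :
    f w = ε * w + f 0 := by
  have hder : ∀ w, deriv f w = ε := by
    intro w
    have hg : HasDerivAt (fun w : ℝ => ε * w + f 0) ε w := by
      simpa using ((hasDerivAt_id w).const_mul ε).add_const (f 0)
    have c1 := (hf w).hasDerivAt.cos
    have s1 := (hf w).hasDerivAt.sin
    rw [show (fun x => Real.cos (f x)) = fun x => Real.cos (ε * x + f 0) from funext hc] at c1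
    rw [show (fun x => Real.sin (f x)) = fun x => Real.sin (ε * x + f 0) from funext hs] at s1
    have c2 := c1.unique hg.cos
    have s2 := s1.unique hg.sin
    rw [hs] at c2
    rw [hc] at s2
    have := Real.sin_sq_add_cos_sq (ε * w + f 0)
    linear_combination (ε - deriv f w) * this - Real.sin (ε * w + f 0) * c2
      + Real.cos (ε * w + f 0) * s2
  have hk := is_const_of_deriv_eq_zero (f := fun w => f w - ε * w)
    (hf.sub (differentiable_id.const_mul ε)) (by
      intro x
      have hg : HasDerivAt (fun w : ℝ => ε * w) ε x := by
        simpa using ((hasDerivAt_id x).const_mul ε)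
      have := ((hf x).hasDerivAt.sub hg).deriv
      rw [hder, sub_self] at this
      exact this) w 0
  simp only [mul_zero, sub_zero] at hk
  linarith

lemma aux_point (L : (ℝ × ℝ) →L[ℝ] (ℝ × ℝ)) (hL : Function.Bijective L)
    (a b c a' b' c' : ℝ × ℝ) (hab : LinearIndependent ℝ ![a, b])
    (hab' : LinearIndependent ℝ ![a', b']) (f : ℝ → ℝ) (hf : Differentiable ℝ f)
    (h : ∀ w, L (Real.cos (f w) • a + Real.sin (f w) • b + c)
      = Real.cos w • a' + Real.sin w • b' + c') :
    ∃ ε : ℝ, (ε = 1 ∨ ε = -1) ∧ (∀ w, f w = ε * w + f 0) ∧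
      L (Real.cos (f 0) • a + Real.sin (f 0) • b) = a' ∧
      ε • L ((-Real.sin (f 0)) • a + Real.cos (f 0) • b) = b' ∧ L c = c' := by
  obtain ⟨P, hP⟩ := hL.2 a'
  obtain ⟨Q, hQ⟩ := hL.2 b'
  obtain ⟨R, hR⟩ := hL.2 c'
  obtain ⟨p, s, rfl⟩ := aux_span a b P hab
  obtain ⟨q, t, rfl⟩ := aux_span a b Q hab
  obtain ⟨r, u, hru⟩ := aux_span a b (R - c) hab
  obtain rfl : R = r • a + u • b + c := by rw [← hru]; abel
  rw [LinearIndependent.pair_iff] at hab hab'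
  have key : ∀ w, Real.cos (f w) = p * Real.cos w + q * Real.sin w + r ∧
      Real.sin (f w) = s * Real.cos w + t * Real.sin w + u := by
    intro w
    have h1 := h w
    rw [← hP, ← hQ, ← hR, ← map_smul, ← map_smul, ← map_add, ← map_add] at h1
    have h2 := hL.1 h1
    have h3 := hab (Real.cos (f w) - (p * Real.cos w + q * Real.sin w + r))
      (Real.sin (f w) - (s * Real.cos w + t * Real.sin w + u)) (by
        rw [← sub_eq_zero] at h2
        rw [← h2]
        module)
    exact ⟨sub_eq_zero.1 h3.1, sub_eq_zero.1 h3.2⟩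
  have hd : p * t - q * s ≠ 0 := by
    intro hd
    have k1 := hab' t (-s) (by
      rw [← hP, ← hQ, ← map_smul, ← map_smul, ← map_add]
      have : t • (p • a + s • b) + (-s) • (q • a + t • b) = (p * t - q * s) • a := by module
      rw [this, hd, zero_smul, map_zero])
    have k2 := hab' q (-p) (by
      rw [← hP, ← hQ, ← map_smul, ← map_smul, ← map_add]
      have : q • (p • a + s • b) + (-p) • (q • a + t • b) = (-(p * t - q * s)) • b := by module
      rw [this, hd, neg_zero, zero_smul, map_zero])
    have k3 := hab' 1 0 (by
      have hp : p = 0 := by linarith [k2.2]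
      have hs : s = 0 := by linarith [k1.2]
      rw [← hP, hp, hs]; simp)
    exact one_ne_zero k3.1
  obtain ⟨hr, hu, hqt⟩ := aux_alg p q r s t u (by
    intro w
    rw [← (key w).1, ← (key w).2]
    exact Real.cos_sq_add_sin_sq _) hd
  subst hr hu
  have k0 := key 0
  simp only [Real.cos_zero, Real.sin_zero, mul_one, mul_zero, add_zero] at k0 key
  have hc : L c = c' := by rw [← hR]; simp
  have ha : L (Real.cos (f 0) • a + Real.sin (f 0) • b) = a' := by rw [k0.1, k0.2, hP]
  rcases hqt with ⟨rfl, rfl⟩ | ⟨rfl, rfl⟩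
  · refine ⟨1, Or.inl rfl, ?_, ha, ?_, hc⟩
    · apply aux_lift f hf
      · intro w
        rw [(key w).1, Real.cos_add, k0.1, k0.2, one_mul]; ring
      · intro w
        rw [(key w).2, Real.sin_add, k0.1, k0.2, one_mul]; ring
    · rw [one_smul, k0.1, k0.2, hQ]
  · refine ⟨-1, Or.inr rfl, ?_, ha, ?_, hc⟩
    · apply aux_lift f hf
      · intro w
        rw [(key w).1, Real.cos_add, k0.1, k0.2, neg_one_mul, Real.cos_neg, Real.sin_neg]; ring
      · intro w
        rw [(key w).2, Real.sin_add, k0.1, k0.2, neg_one_mul, Real.cos_neg, Real.sin_neg]; ring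
    · rw [← map_smul, k0.1, k0.2, ← hQ]
      congr 1
      module

/-- two elliptic systems `ẋ = A cos w + B sin w + C` and
`ẋ' = A' cos w' + B' sin w' + C'` are locally feedback equivalent via a local
diffeomorphism `φ` and a reparametrisation `w = ψ(x, w')` iff `ψ(x,w') = ε·w' + α(x)` with
`ε = ±1`, `α` smooth, and `A' = φ∗(A cos α + B sin α)`,
`B' = ε·φ∗(−A sin α + B cos α)`, `C' = φ∗C`. -/
theorem stmt_11 (U U' : Set (ℝ × ℝ)) (hU : IsOpen U) (hU' : IsOpen U')
    (x₀ x₀' : ℝ × ℝ) (hx₀ : x₀ ∈ U) (hx₀' : x₀' ∈ U')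
    (A B C : (ℝ × ℝ) → ℝ × ℝ) (A' B' C' : (ℝ × ℝ) → ℝ × ℝ)
    (hA : ContDiffOn ℝ (⊤ : ℕ∞) A U) (hB : ContDiffOn ℝ (⊤ : ℕ∞) B U) (hC : ContDiffOn ℝ (⊤ : ℕ∞) C U)
    (hA' : ContDiffOn ℝ (⊤ : ℕ∞) A' U') (hB' : ContDiffOn ℝ (⊤ : ℕ∞) B' U') (hC' : ContDiffOn ℝ (⊤ : ℕ∞) C' U')
    (hAB : ∀ x ∈ U, LinearIndependent ℝ ![A x, B x])
    (hAB' : ∀ x ∈ U', LinearIndependent ℝ ![A' x, B' x])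
    (φ : (ℝ × ℝ) → (ℝ × ℝ)) (ψ : (ℝ × ℝ) → ℝ → ℝ)
    (hφ : ContDiffOn ℝ (⊤ : ℕ∞) φ U) (hφd : ∀ x ∈ U, Function.Bijective (fderiv ℝ φ x))
    (hφx₀ : φ x₀ = x₀') (hφU : ∀ x ∈ U, φ x ∈ U')
    (hψ : ContDiffOn ℝ (⊤ : ℕ∞) (fun p : (ℝ × ℝ) × ℝ => ψ p.1 p.2) (U ×ˢ univ)) :
    -- Ξ_E and Ξ~_E are locally feedback equivalent via φ and ψ ...
    (∃ U₀ : Set (ℝ × ℝ), IsOpen U₀ ∧ x₀ ∈ U₀ ∧ U₀ ⊆ U ∧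
      (∀ x ∈ U₀, ∀ w' : ℝ, deriv (ψ x) w' ≠ 0) ∧
      (∀ x ∈ U₀, ∀ w' : ℝ,
        fderiv ℝ φ x (Real.cos (ψ x w') • A x + Real.sin (ψ x w') • B x + C x)
          = Real.cos w' • A' (φ x) + Real.sin w' • B' (φ x) + C' (φ x)))
    ↔
    -- ... iff ψ = ε w' + α and the pushforward relations hold
    (∃ U₀ : Set (ℝ × ℝ), IsOpen U₀ ∧ x₀ ∈ U₀ ∧ U₀ ⊆ U ∧
      ∃ (ε : ℝ) (α : (ℝ × ℝ) → ℝ), (ε = 1 ∨ ε = -1) ∧ ContDiffOn ℝ (⊤ : ℕ∞) α U₀ ∧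
        (∀ x ∈ U₀, ∀ w' : ℝ, ψ x w' = ε * w' + α x) ∧
        (∀ x ∈ U₀,
          fderiv ℝ φ x (Real.cos (α x) • A x + Real.sin (α x) • B x) = A' (φ x)) ∧
        (∀ x ∈ U₀,
          ε • fderiv ℝ φ x ((-Real.sin (α x)) • A x + Real.cos (α x) • B x) = B' (φ x)) ∧
        (∀ x ∈ U₀, fderiv ℝ φ x (C x) = C' (φ x))) := by
  have hsl : ∀ w : ℝ, ContDiffOn ℝ (⊤ : ℕ∞) (fun x => ψ x w) U := by
    intro w
    exact hψ.comp (f := fun x : ℝ × ℝ => (x, w)) (contDiff_id.prodMk contDiff_const).contDiffOn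
      (fun x hx => ⟨hx, mem_univ _⟩)
  have hsd : ∀ x ∈ U, Differentiable ℝ (ψ x) := by
    intro x hx
    have h1 : ContDiffOn ℝ (⊤ : ℕ∞) (fun w : ℝ => ψ x w) univ :=
      hψ.comp (f := fun w : ℝ => (x, w)) (contDiff_const.prodMk contDiff_id).contDiffOn
        (fun w _ => ⟨hx, mem_univ _⟩)
    exact (contDiffOn_univ.1 h1).differentiable (by simp)
  constructor
  · rintro ⟨U₀, hU₀, hx, hsub, -, h⟩
    have hpt := fun x (hx : x ∈ U₀) => aux_point (fderiv ℝ φ x) (hφd x (hsub hx)) (A x) (B x) (C x)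
      (A' (φ x)) (B' (φ x)) (C' (φ x)) (hAB x (hsub hx)) (hAB' _ (hφU x (hsub hx))) (ψ x)
      (hsd x (hsub hx)) (h x hx)
    obtain ⟨ε, hε, hε1, -⟩ := hpt x₀ hx
    have hcont : ContinuousOn (fun x => ε * (ψ x 1 - ψ x 0)) U₀ :=
      (continuousOn_const.mul ((hsl 1).continuousOn.sub (hsl 0).continuousOn)).mono hsub
    refine ⟨U₀ ∩ (fun x => ε * (ψ x 1 - ψ x 0)) ⁻¹' Ioi 0,
      hcont.isOpen_inter_preimage hU₀ isOpen_Ioi, ⟨hx, ?_⟩, fun x hx => hsub hx.1,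
      ε, fun x => ψ x 0, hε, (hsl 0).mono (fun x hx => hsub hx.1), ?_⟩
    · have := hε1 1
      simp only [mem_preimage, mem_Ioi]
      rw [this]
      rcases hε with rfl | rfl <;> norm_num
    · have hpt' : ∀ x ∈ U₀ ∩ (fun x => ε * (ψ x 1 - ψ x 0)) ⁻¹' Ioi 0,
          (∀ w : ℝ, ψ x w = ε * w + ψ x 0) ∧
          fderiv ℝ φ x (Real.cos (ψ x 0) • A x + Real.sin (ψ x 0) • B x) = A' (φ x) ∧
          ε • fderiv ℝ φ x ((-Real.sin (ψ x 0)) • A x + Real.cos (ψ x 0) • B x) = B' (φ x) ∧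
          fderiv ℝ φ x (C x) = C' (φ x) := by
        intro x hx
        obtain ⟨e, he, he1, h2⟩ := hpt x hx.1
        have hpos : 0 < ε * (ψ x 1 - ψ x 0) := hx.2
        rw [he1 1] at hpos
        have hee : e = ε := by
          rcases hε with rfl | rfl <;> rcases he with rfl | rfl <;> first | rfl | (exfalso; linarith)
        rw [hee] at he1 h2
        exact And.intro he1 h2
      exact ⟨fun x hx => (hpt' x hx).1, fun x hx => (hpt' x hx).2.1,
        fun x hx => (hpt' x hx).2.2.1, fun x hx => (hpt' x hx).2.2.2⟩
  · rintro ⟨U₀, hU₀, hx, hsub, ε, α, hε, -, hψe, ha, hb, hc⟩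
    refine ⟨U₀, hU₀, hx, hsub, ?_, ?_⟩
    · intro x hx w
      have hg : HasDerivAt (fun w : ℝ => ε * w + α x) ε w := by
        simpa using ((hasDerivAt_id w).const_mul ε).add_const (α x)
      rw [show ψ x = fun w => ε * w + α x from funext (hψe x hx), hg.deriv]
      rcases hε with rfl | rfl <;> norm_num
    · intro x hx w
      rw [hψe x hx, ← ha x hx, ← hb x hx, ← hc x hx, Real.cos_add, Real.sin_add]
      simp only [map_add, map_smul]
      rcases hε with rfl | rfl
      · rw [one_mul]; module
      · rw [neg_one_mul, Real.cos_neg, Real.sin_neg]; module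
end
end

section
/- Let Ξ_P: ẋ = A(x)w² + B(x)w + C(x) and Ξ~_P: ẋ~ = A~(x~)w~² + B~(x~)w~ + C~(x~) be two parabolic systems (A, B, C and A~, B~, C~ smooth vector fields on open subsets of ℝ² with A∧B ≠ 0 and A~∧B~ ≠ 0). Then Ξ_P and Ξ~_P are locally feedback equivalent via a local diffeomorphism x~ = φ(x) and a reparametrisation w = ψ(x,w~) if and only if ψ(x,w~) = α(x) + β(x)·w~ with α, β smooth, β nonvanishing, and A~ = φ∗(Aβ²), B~ = φ∗(2Aαβ + Bβ), C~ = φ∗(C + Aα² + Bα). -/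
noncomputable section

open Set

theorem aux_det (a b : ℝ × ℝ)
    (h : ∀ s t : ℝ, s • a + t • b = 0 → s = 0 ∧ t = 0) : a.1 * b.2 - a.2 * b.1 ≠ 0 := by
  intro hd
  have h1 := h b.1 (-a.1) (by ext <;> simp <;> linarith)
  have h2 := h b.2 (-a.2) (by ext <;> simp <;> linarith)
  have h3 := h 1 0 (by ext <;> simp <;> linarith [h1.2, h2.2])
  exact one_ne_zero h3.1

theorem aux_affine (f : ℝ → ℝ) (a b c a' b' c' : ℝ × ℝ)
    (hd : a.1 * b.2 - a.2 * b.1 ≠ 0)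
    (h : ∀ w : ℝ, (f w) ^ 2 • a + f w • b + c = w ^ 2 • a' + w • b' + c') (w : ℝ) :
    f w = f 0 + (f 1 - f 0) * w := by
  have e1 : ∀ w, (f w) ^ 2 * a.1 + f w * b.1 + c.1 = w ^ 2 * a'.1 + w * b'.1 + c'.1 :=
    fun w => by simpa using congrArg Prod.fst (h w)
  have e2 : ∀ w, (f w) ^ 2 * a.2 + f w * b.2 + c.2 = w ^ 2 * a'.2 + w * b'.2 + c'.2 :=
    fun w => by simpa using congrArg Prod.snd (h w)
  clear h
  obtain ⟨d, hdd⟩ : ∃ d, d = a.1 * b.2 - a.2 * b.1 := ⟨_, rfl⟩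
  rw [← hdd] at hd
  obtain ⟨p, q, r, hf⟩ : ∃ p q r : ℝ, ∀ w, f w = p * w ^ 2 + q * w + r := by
    refine ⟨(a.1 * a'.2 - a.2 * a'.1) / d, (a.1 * b'.2 - a.2 * b'.1) / d,
      (a.1 * (c'.2 - c.2) - a.2 * (c'.1 - c.1)) / d, fun w => ?_⟩
    field_simp
    rw [hdd]
    linear_combination a.1 * e2 w - a.2 * e1 w
  obtain ⟨p', q', r', hf'⟩ : ∃ p q r : ℝ, ∀ w, f w ^ 2 = p * w ^ 2 + q * w + r := by
    refine ⟨(b.2 * a'.1 - b.1 * a'.2) / d, (b.2 * b'.1 - b.1 * b'.2) / d,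
      (b.2 * (c'.1 - c.1) - b.1 * (c'.2 - c.2)) / d, fun w => ?_⟩
    field_simp
    rw [hdd]
    linear_combination b.2 * e1 w - b.1 * e2 w
  have hp : p = 0 := by
    have h0 := hf' 0
    have h1 := hf' 1
    have h2 := hf' 2
    have h3 := hf' (-1)
    have h4 := hf' (-2)
    rw [hf] at h0 h1 h2 h3 h4
    have : p ^ 2 = 0 := by
      linear_combination (h2 + h4 - 4 * h1 - 4 * h3 + 6 * h0) / 24
    exact pow_eq_zero_iff (two_ne_zero) |>.1 this
  rw [hf w, hf 0, hf 1, hp]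
  ring

/-- two parabolic systems `ẋ = A w² + B w + C` and
`ẋ' = A' w'² + B' w' + C'` are locally feedback equivalent via a local diffeomorphism `φ`
and a reparametrisation `w = ψ(x,w')` iff `ψ(x,w') = α(x) + β(x)·w'` with `α, β` smooth,
`β` nonvanishing, and `A' = φ∗(Aβ²)`, `B' = φ∗(2Aαβ + Bβ)`, `C' = φ∗(C + Aα² + Bα)`. -/
theorem stmt_12 (U U' : Set (ℝ × ℝ)) (hU : IsOpen U) (hU' : IsOpen U')
    (x₀ x₀' : ℝ × ℝ) (hx₀ : x₀ ∈ U) (hx₀' : x₀' ∈ U')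
    (A B C : (ℝ × ℝ) → ℝ × ℝ) (A' B' C' : (ℝ × ℝ) → ℝ × ℝ)
    (hA : ContDiffOn ℝ (⊤ : ℕ∞) A U) (hB : ContDiffOn ℝ (⊤ : ℕ∞) B U) (hC : ContDiffOn ℝ (⊤ : ℕ∞) C U)
    (hA' : ContDiffOn ℝ (⊤ : ℕ∞) A' U') (hB' : ContDiffOn ℝ (⊤ : ℕ∞) B' U') (hC' : ContDiffOn ℝ (⊤ : ℕ∞) C' U')
    (hAB : ∀ x ∈ U, LinearIndependent ℝ ![A x, B x])
    (hAB' : ∀ x ∈ U', LinearIndependent ℝ ![A' x, B' x])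
    (φ : (ℝ × ℝ) → (ℝ × ℝ)) (ψ : (ℝ × ℝ) → ℝ → ℝ)
    (hφ : ContDiffOn ℝ (⊤ : ℕ∞) φ U) (hφd : ∀ x ∈ U, Function.Bijective (fderiv ℝ φ x))
    (hφx₀ : φ x₀ = x₀') (hφU : ∀ x ∈ U, φ x ∈ U')
    (hψ : ContDiffOn ℝ (⊤ : ℕ∞) (fun p : (ℝ × ℝ) × ℝ => ψ p.1 p.2) (U ×ˢ univ)) :
    -- Ξ_P and Ξ~_P are locally feedback equivalent via φ and ψ ...
    (∃ U₀ : Set (ℝ × ℝ), IsOpen U₀ ∧ x₀ ∈ U₀ ∧ U₀ ⊆ U ∧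
      (∀ x ∈ U₀, ∀ w' : ℝ, deriv (ψ x) w' ≠ 0) ∧
      (∀ x ∈ U₀, ∀ w' : ℝ,
        fderiv ℝ φ x ((ψ x w') ^ 2 • A x + (ψ x w') • B x + C x)
          = w' ^ 2 • A' (φ x) + w' • B' (φ x) + C' (φ x)))
    ↔
    -- ... iff ψ = α + β w' with β nonvanishing and the pushforward relations hold
    (∃ U₀ : Set (ℝ × ℝ), IsOpen U₀ ∧ x₀ ∈ U₀ ∧ U₀ ⊆ U ∧
      ∃ (α β : (ℝ × ℝ) → ℝ), ContDiffOn ℝ (⊤ : ℕ∞) α U₀ ∧ ContDiffOn ℝ (⊤ : ℕ∞) β U₀ ∧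
        (∀ x ∈ U₀, β x ≠ 0) ∧
        (∀ x ∈ U₀, ∀ w' : ℝ, ψ x w' = α x + β x * w') ∧
        (∀ x ∈ U₀, fderiv ℝ φ x ((β x) ^ 2 • A x) = A' (φ x)) ∧
        (∀ x ∈ U₀,
          fderiv ℝ φ x ((2 * α x * β x) • A x + β x • B x) = B' (φ x)) ∧
        (∀ x ∈ U₀,
          fderiv ℝ φ x (C x + (α x) ^ 2 • A x + α x • B x) = C' (φ x))) := by
  constructor
  · rintro ⟨U₀, hO, hx, hsub, hder, heq⟩
    have hsm : ∀ c : ℝ, ContDiffOn ℝ (⊤ : ℕ∞) (fun x => ψ x c) U₀ := fun c =>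
      hψ.comp (f := fun x : ℝ × ℝ => (x, c)) (by fun_prop) (fun x hx => ⟨hsub hx, mem_univ _⟩)
    have haff : ∀ x ∈ U₀, ∀ w : ℝ, ψ x w = ψ x 0 + (ψ x 1 - ψ x 0) * w := by
      intro x hx w
      refine aux_affine (ψ x) (fderiv ℝ φ x (A x)) (fderiv ℝ φ x (B x)) (fderiv ℝ φ x (C x))
        (A' (φ x)) (B' (φ x)) (C' (φ x)) ?_ ?_ w
      · apply aux_det
        intro s t hst
        rw [← map_smul, ← map_smul, ← map_add] at hst
        have := (hφd x (hsub hx)).1 (hst.trans (map_zero (fderiv ℝ φ x)).symm)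
        exact LinearIndependent.pair_iff.1 (hAB x (hsub hx)) s t this
      · intro w
        rw [← heq x hx w]
        simp only [map_add, map_smul]
    have key : ∀ x ∈ U₀, ∀ w : ℝ,
        (ψ x 0 + (ψ x 1 - ψ x 0) * w) ^ 2 • fderiv ℝ φ x (A x)
          + (ψ x 0 + (ψ x 1 - ψ x 0) * w) • fderiv ℝ φ x (B x) + fderiv ℝ φ x (C x)
          = w ^ 2 • A' (φ x) + w • B' (φ x) + C' (φ x) := by
      intro x hx w
      rw [← haff x hx w, ← heq x hx w]
      simp only [map_add, map_smul]
    refine ⟨U₀, hO, hx, hsub, fun x => ψ x 0, fun x => ψ x 1 - ψ x 0, hsm 0,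
      (hsm 1).sub (hsm 0), ?_, haff, ?_, ?_, ?_⟩
    · intro x hx h0
      apply hder x hx 0
      have : ψ x = fun _ => ψ x 0 := by
        funext w
        have := haff x hx w
        simp only at h0
        rw [h0] at this
        linarith
      rw [this]
      simp
    all_goals
      intro x hx
      have k0 := key x hx 0
      have k1 := key x hx 1
      have k2 := key x hx (-1)
      simp only [map_add, map_smul]
      generalize ψ x 1 - ψ x 0 = β at *
      generalize ψ x 0 = α at *
    · linear_combination (norm := module) (1/2 : ℝ) • k1 + (1/2 : ℝ) • k2 - k0
    · linear_combination (norm := module) (1/2 : ℝ) • k1 - (1/2 : ℝ) • k2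
    · linear_combination (norm := module) k0
  · rintro ⟨U₀, hO, hx, hsub, α, β, hα, hβ, hne, haff, h1, h2, h3⟩
    refine ⟨U₀, hO, hx, hsub, ?_, ?_⟩
    · intro x hx w
      have : ψ x = fun w => α x + β x * w := funext (haff x hx)
      rw [this]
      have hd : HasDerivAt (fun w => α x + β x * w) (β x) w := by
        simpa using ((hasDerivAt_id w).const_mul (β x)).const_add (α x)
      rw [hd.deriv]
      exact hne x hx
    · intro x hx w
      rw [haff x hx w, ← h1 x hx, ← h2 x hx, ← h3 x hx]
      simp only [map_add, map_smul]
      module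
end
end

section
/- Consider a constant-form elliptic system on ℝ² near 0, Ξ: ż = cos w + c₀, ẏ = sin w + c₁, with constants (c₀, c₁) ∈ ℝ². Then Ξ is locally feedback equivalent at 0 to the canonical form Ξ^Γ: ż = cos w + √Γ, ẏ = sin w, where Γ = c₀² + c₁². Moreover, two canonical forms Ξ^Γ and Ξ^Γ~ (with constants Γ, Γ~ ≥ 0) are locally feedback equivalent if and only if Γ = Γ~. -/
noncomputable section

open Set

/-- Local feedback equivalence at `p ↦ p'` of the control systems `ẋ = F(x,w)` and
`ẋ' = F'(x',w')` on `ℝ²`: there are a local diffeomorphism `φ` and a smooth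
reparametrisation `w = ψ(x,w')` with `∂ψ/∂w' ≠ 0` such that
`Dφ(x)·F(x, ψ(x,w')) = F'(φ(x), w')`. -/
def FbEquiv2 (F F' : (ℝ × ℝ) → ℝ → ℝ × ℝ) (p p' : ℝ × ℝ) : Prop :=
  ∃ (φ : (ℝ × ℝ) → ℝ × ℝ) (ψ : (ℝ × ℝ) → ℝ → ℝ) (U₀ : Set (ℝ × ℝ)),
    IsOpen U₀ ∧ p ∈ U₀ ∧
    ContDiffOn ℝ (⊤ : ℕ∞) φ U₀ ∧ (∀ x ∈ U₀, Function.Bijective (fderiv ℝ φ x)) ∧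
    φ p = p' ∧
    ContDiffOn ℝ (⊤ : ℕ∞) (fun q : (ℝ × ℝ) × ℝ => ψ q.1 q.2) (U₀ ×ˢ univ) ∧
    (∀ x ∈ U₀, ∀ w' : ℝ, deriv (ψ x) w' ≠ 0) ∧
    (∀ x ∈ U₀, ∀ w' : ℝ, fderiv ℝ φ x (F x (ψ x w')) = F' (φ x) w')

/-- Rotation by the angle `-θ`. -/
def rotCLM (θ : ℝ) : (ℝ × ℝ) →L[ℝ] (ℝ × ℝ) :=
  (Real.cos θ • ContinuousLinearMap.fst ℝ ℝ ℝ + Real.sin θ • ContinuousLinearMap.snd ℝ ℝ ℝ).prod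
    (-Real.sin θ • ContinuousLinearMap.fst ℝ ℝ ℝ + Real.cos θ • ContinuousLinearMap.snd ℝ ℝ ℝ)

lemma rotCLM_apply (θ a b : ℝ) : rotCLM θ (a, b) =
    (Real.cos θ * a + Real.sin θ * b, -Real.sin θ * a + Real.cos θ * b) := by
  simp [rotCLM]

lemma rotCLM_bij (θ : ℝ) : Function.Bijective (rotCLM θ) := by
  have h := Real.sin_sq_add_cos_sq θ
  refine Function.bijective_iff_has_inverse.2 ⟨rotCLM (-θ), ?_, ?_⟩ <;>
  · rintro ⟨a, b⟩
    simp only [rotCLM_apply, Real.cos_neg, Real.sin_neg, Prod.mk.injEq]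
    constructor
    · linear_combination a * h
    · linear_combination b * h

lemma part_one (c₀ c₁ : ℝ) :
    FbEquiv2 (fun _ w => (Real.cos w + c₀, Real.sin w + c₁))
      (fun _ w => (Real.cos w + Real.sqrt (c₀ ^ 2 + c₁ ^ 2), Real.sin w))
      (0 : ℝ × ℝ) (0 : ℝ × ℝ) := by
  obtain ⟨θ, h0, h1⟩ : ∃ θ : ℝ, Real.sqrt (c₀ ^ 2 + c₁ ^ 2) * Real.cos θ = c₀ ∧
      Real.sqrt (c₀ ^ 2 + c₁ ^ 2) * Real.sin θ = c₁ := by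
    refine ⟨Complex.arg ⟨c₀, c₁⟩, ?_, ?_⟩
    · have := Complex.norm_mul_cos_arg ⟨c₀, c₁⟩
      rwa [Complex.norm_eq_sqrt_sq_add_sq] at this
    · have := Complex.norm_mul_sin_arg ⟨c₀, c₁⟩
      rwa [Complex.norm_eq_sqrt_sq_add_sq] at this
  generalize Real.sqrt (c₀ ^ 2 + c₁ ^ 2) = r at *
  refine ⟨rotCLM θ, fun _ w => w + θ, univ, isOpen_univ, mem_univ _,
    (rotCLM θ).contDiff.contDiffOn, ?_, map_zero _, ?_, ?_, ?_⟩
  · intro x _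
    rw [ContinuousLinearMap.fderiv]
    exact rotCLM_bij θ
  · exact (contDiff_snd.add contDiff_const).contDiffOn
  · intro x _ w
    simp
  · intro x _ w
    have h := Real.sin_sq_add_cos_sq θ
    simp only [ContinuousLinearMap.fderiv, rotCLM_apply, Prod.mk.injEq, Real.cos_add, Real.sin_add]
    rw [← h0, ← h1]
    constructor
    · linear_combination (Real.cos w + r) * h
    · linear_combination (Real.sin w) * h

lemma part_two (s t : ℝ) (hs : 0 ≤ s) (ht : 0 ≤ t) (A : (ℝ × ℝ) →L[ℝ] (ℝ × ℝ))
    (hA : Function.Bijective A) (f : ℝ → ℝ)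
    (h : ∀ w, A (Real.cos (f w) + s, Real.sin (f w)) = (Real.cos w + t, Real.sin w)) :
    s = t := by
  obtain ⟨p, hp⟩ := hA.2 (1, 0)
  obtain ⟨q, hq⟩ := hA.2 (0, 1)
  have key : ∀ z : ℝ × ℝ, z = (A z).1 • p + (A z).2 • q := by
    intro z
    apply hA.1
    rw [map_add, map_smul, map_smul, hp, hq]
    simp
  have e : ∀ w, (Real.cos w * p.1 + Real.sin w * q.1 + (t * p.1 - s)) ^ 2 +
      (Real.cos w * p.2 + Real.sin w * q.2 + t * p.2) ^ 2 = 1 := by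
    intro w
    have k := key (Real.cos (f w) + s, Real.sin (f w))
    rw [h w] at k
    have k1 := congrArg Prod.fst k
    have k2 := congrArg Prod.snd k
    simp at k1 k2
    have g := Real.sin_sq_add_cos_sq (f w)
    have k1' : Real.cos w * p.1 + Real.sin w * q.1 + (t * p.1 - s) = Real.cos (f w) := by
      linarith
    have k2' : Real.cos w * p.2 + Real.sin w * q.2 + t * p.2 = Real.sin (f w) := by
      linarith
    rw [k1', k2']
    linarith
  have e1 := e 0
  have e2 := e Real.pi
  have e3 := e (Real.pi / 2)
  have e4 := e (-(Real.pi / 2))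
  simp at e1 e2 e3 e4
  have kv := key (t * p.1 - s, t * p.2)
  generalize A (t * p.1 - s, t * p.2) = z at kv
  have k1 := congrArg Prod.fst kv
  have k2 := congrArg Prod.snd kv
  simp at k1 k2
  have d1 : p.1 * (t * p.1 - s) + p.2 * (t * p.2) = 0 := by linarith
  have d2 : q.1 * (t * p.1 - s) + q.2 * (t * p.2) = 0 := by linarith
  have vv : (t * p.1 - s) ^ 2 + (t * p.2) ^ 2 = 0 := by
    linear_combination (t * p.1 - s) * k1 + (t * p.2) * k2 + z.1 * d1 + z.2 * d2
  have v1 : t * p.1 - s = 0 := by nlinarith [sq_nonneg (t * p.1 - s), sq_nonneg (t * p.2)]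
  have v2 : t * p.2 = 0 := by nlinarith [sq_nonneg (t * p.1 - s), sq_nonneg (t * p.2)]
  rw [v1, v2] at e1
  have : s ^ 2 = t ^ 2 := by
    linear_combination t ^ 2 * e1 - (t * p.1 + s) * v1 - t * p.2 * v2
  exact (sq_eq_sq₀ hs ht).1 this

/-- every constant-form elliptic system `ż = cos w + c₀, ẏ = sin w + c₁`
is locally feedback equivalent at `0` to the canonical form
`ż = cos w + √Γ, ẏ = sin w` with `Γ = c₀² + c₁²`; and two canonical forms `Ξ^Γ`, `Ξ^Γ'`
(`Γ, Γ' ≥ 0`) are locally feedback equivalent iff `Γ = Γ'`. -/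
theorem stmt_16 :
    (∀ c₀ c₁ : ℝ,
      FbEquiv2 (fun _ w => (Real.cos w + c₀, Real.sin w + c₁))
        (fun _ w => (Real.cos w + Real.sqrt (c₀ ^ 2 + c₁ ^ 2), Real.sin w))
        (0 : ℝ × ℝ) (0 : ℝ × ℝ)) ∧
    (∀ Γ Γ' : ℝ, 0 ≤ Γ → 0 ≤ Γ' →
      (FbEquiv2 (fun _ w => (Real.cos w + Real.sqrt Γ, Real.sin w))
        (fun _ w => (Real.cos w + Real.sqrt Γ', Real.sin w))
        (0 : ℝ × ℝ) (0 : ℝ × ℝ) ↔ Γ = Γ')) := by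
  refine ⟨part_one, fun Γ Γ' hΓ hΓ' => ⟨?_, ?_⟩⟩
  · rintro ⟨φ, ψ, U, -, h0, -, hb, -, -, -, h⟩
    have := part_two _ _ (Real.sqrt_nonneg Γ) (Real.sqrt_nonneg Γ') (fderiv ℝ φ 0) (hb 0 h0) (ψ 0)
      (h 0 h0)
    exact (Real.sqrt_inj hΓ hΓ').1 this
  · rintro rfl
    have := part_one (Real.sqrt Γ) 0
    simpa [Real.sq_sqrt hΓ] using this
end
end

section
/- Consider a constant-form hyperbolic system on ℝ² near 0, Ξ: ż = cosh w + c₀, ẏ = sinh w + c₁, with constants (c₀, c₁) ∈ ℝ², and set Γ = c₀² − c₁². Then Ξ is locally feedback equivalent at 0 to exactly one of the canonical forms: (a) ż = cosh w + ε√Γ, ẏ = sinh w, when Γ > 0, with ε = sgn(c₀) ∈ {1,−1}; (b) ż = cosh w, ẏ = sinh w + √(−Γ), when Γ < 0; (c) ż = cosh w + ε, ẏ = sinh w + 1, when Γ = 0 and c₀ ≠ 0, with ε = sgn(c₀); (d) ż = cosh w, ẏ = sinh w, when c₀ = c₁ = 0. Moreover, the pair (Γ, ε) is a complete invariant: two constant-form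 hyperbolic systems are locally feedback equivalent if and only if they have the same Γ and (in cases (a) and (c)) the same ε. -/
noncomputable section

open Set

/-- The constant-form hyperbolic system `ż = cosh w + c₀, ẏ = sinh w + c₁`. -/
def hypSys (c₀ c₁ : ℝ) : (ℝ × ℝ) → ℝ → ℝ × ℝ :=
  fun _ w => (Real.cosh w + c₀, Real.sinh w + c₁)

lemma fb_of_params (c₀ c₁ c₀' c₁' σ l : ℝ) (hσ : σ = 1 ∨ σ = -1)
    (h0 : c₀' = Real.cosh l * c₀ + Real.sinh l * (σ * c₁))
    (h1 : c₁' = Real.sinh l * c₀ + Real.cosh l * (σ * c₁)) :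
    FbEquiv2 (hypSys c₀ c₁) (hypSys c₀' c₁') (0 : ℝ × ℝ) (0 : ℝ × ℝ) := by
  have hs : σ * σ = 1 := by rcases hσ with h | h <;> rw [h] <;> norm_num
  let L : (ℝ × ℝ) →L[ℝ] (ℝ × ℝ) :=
    (Real.cosh l • ContinuousLinearMap.fst ℝ ℝ ℝ +
      (Real.sinh l * σ) • ContinuousLinearMap.snd ℝ ℝ ℝ).prod
    (Real.sinh l • ContinuousLinearMap.fst ℝ ℝ ℝ +
      (Real.cosh l * σ) • ContinuousLinearMap.snd ℝ ℝ ℝ)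
  have hL : ∀ v : ℝ × ℝ, L v = (Real.cosh l * v.1 + Real.sinh l * σ * v.2,
      Real.sinh l * v.1 + Real.cosh l * σ * v.2) := by
    intro v; simp [L]
  have hcs := Real.cosh_sq l
  refine ⟨L, fun _ w => σ * (w - l), univ, isOpen_univ, mem_univ _, L.contDiff.contDiffOn,
    ?_, map_zero L, ?_, ?_, ?_⟩
  · intro x _
    rw [L.fderiv]
    constructor
    · intro v w hvw
      rw [hL, hL, Prod.mk.injEq] at hvw
      obtain ⟨e1, e2⟩ := hvw
      have f1 : v.1 = w.1 := by
        linear_combination Real.cosh l * e1 - Real.sinh l * e2 - (v.1 - w.1) * hcs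
      have f2 : v.2 = w.2 := by
        linear_combination (- Real.sinh l * e1 + Real.cosh l * e2) * σ
          - (v.2 - w.2) * (hcs) * (σ * σ) - (v.2 - w.2) * hs
      exact Prod.ext f1 f2
    · intro v
      refine ⟨(Real.cosh l * v.1 - Real.sinh l * v.2,
        σ * (- Real.sinh l * v.1 + Real.cosh l * v.2)), ?_⟩
      rw [hL]
      ext
      · simp only
        linear_combination v.1 * hcs +
          Real.sinh l * (- Real.sinh l * v.1 + Real.cosh l * v.2) * hs
      · simp only
        linear_combination v.2 * hcs +
          Real.cosh l * (- Real.sinh l * v.1 + Real.cosh l * v.2) * hs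
  · apply ContDiff.contDiffOn
    fun_prop
  · intro x _ w
    have : HasDerivAt (fun w : ℝ => σ * (w - l)) (σ * 1) w :=
      ((hasDerivAt_id w).sub_const l).const_mul σ
    rw [this.deriv]
    rcases hσ with h | h <;> rw [h] <;> norm_num
  · intro x _ w
    rw [L.fderiv, hL]
    have k1 : Real.cosh (σ * (w - l)) = Real.cosh (w - l) := by
      rcases hσ with h | h <;> simp only [h, one_mul, neg_mul, Real.cosh_neg]
    have k2 : Real.sinh (σ * (w - l)) = σ * Real.sinh (w - l) := by
      rcases hσ with h | h <;> simp only [h, one_mul, neg_mul, Real.sinh_neg]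
    have g1 : Real.cosh w = Real.cosh (l + (w - l)) := by congr 1; ring
    have g2 : Real.sinh w = Real.sinh (l + (w - l)) := by congr 1; ring
    rw [Real.cosh_add] at g1
    rw [Real.sinh_add] at g2
    simp only [hypSys, k1, k2, g1, g2, h0, h1]
    ext
    · simp only
      linear_combination Real.sinh l * Real.sinh (w - l) * hs
    · simp only
      linear_combination Real.cosh l * Real.sinh (w - l) * hs

lemma fb_of_scale (c₀ c₁ c₀' c₁' σ a : ℝ) (hσ : σ = 1 ∨ σ = -1) (ha : 0 < a)
    (h0 : c₀' + c₁' = a * (c₀ + σ * c₁))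
    (h1 : a * (c₀' - c₁') = c₀ - σ * c₁) :
    FbEquiv2 (hypSys c₀ c₁) (hypSys c₀' c₁') (0 : ℝ × ℝ) (0 : ℝ × ℝ) := by
  have h2 : c₀' - c₁' = a⁻¹ * (c₀ - σ * c₁) := by
    rw [← h1]; field_simp
  apply fb_of_params c₀ c₁ c₀' c₁' σ (Real.log a) hσ
  · rw [Real.cosh_log ha, Real.sinh_log ha]; linear_combination (h0 + h2) / 2
  · rw [Real.cosh_log ha, Real.sinh_log ha]; linear_combination (h0 - h2) / 2

lemma fb_of_inv (c₀ c₁ c₀' c₁' : ℝ) (hG : c₀ ^ 2 - c₁ ^ 2 = c₀' ^ 2 - c₁' ^ 2)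
    (hs : 0 ≤ c₀ ^ 2 - c₁ ^ 2 → Real.sign c₀ = Real.sign c₀') :
    FbEquiv2 (hypSys c₀ c₁) (hypSys c₀' c₁') (0 : ℝ × ℝ) (0 : ℝ × ℝ) := by
  have key : ∀ x y : ℝ, 0 < x * y → x ≠ 0 ∧ y ≠ 0 ∧ 0 < y / x := by
    intro x y h
    have hx : x ≠ 0 := by rintro rfl; simp at h
    have hy : y ≠ 0 := by rintro rfl; simp at h
    refine ⟨hx, hy, ?_⟩
    have : y / x = x * y / (x ^ 2) := by field_simp
    rw [this]; positivity
  by_cases k1 : 0 < (c₀ + c₁) * (c₀' + c₁')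
  · obtain ⟨hx, hy, h⟩ := key _ _ k1
    apply fb_of_scale _ _ _ _ 1 _ (Or.inl rfl) h
    · field_simp
    · field_simp; linear_combination -hG
  by_cases k2 : 0 < (c₀ - c₁) * (c₀' + c₁')
  · obtain ⟨hx, hy, h⟩ := key _ _ k2
    apply fb_of_scale _ _ _ _ (-1) _ (Or.inr rfl) h
    · field_simp; ring
    · field_simp; linear_combination -hG
  by_cases k3 : 0 < (c₀' - c₁') * (c₀ + c₁)
  · obtain ⟨hx, hy, h⟩ := key _ _ k3
    apply fb_of_scale _ _ _ _ (-1) _ (Or.inr rfl) h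
    · field_simp; linear_combination -hG
    · field_simp; ring
  by_cases k4 : 0 < (c₀' - c₁') * (c₀ - c₁)
  · obtain ⟨hx, hy, h⟩ := key _ _ k4
    apply fb_of_scale _ _ _ _ 1 _ (Or.inl rfl) h
    · field_simp; linear_combination -hG
    · field_simp
  push Not at k1 k2 k3 k4
  rcases lt_or_ge (c₀ ^ 2 - c₁ ^ 2) 0 with hn | hp
  · exfalso
    have e1 : 0 ≤ ((c₀ + c₁) * (c₀' + c₁')) * ((c₀ - c₁) * (c₀' + c₁')) :=
      mul_nonneg_of_nonpos_of_nonpos k1 k2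
    have hne : c₀' + c₁' ≠ 0 := by
      intro h
      have : c₀ ^ 2 - c₁ ^ 2 = 0 := by rw [hG]; linear_combination (c₀' - c₁') * h
      linarith
    have e2 : 0 < (c₀' + c₁') ^ 2 := by positivity
    nlinarith [mul_pos e2 (neg_pos.2 hn)]
  · have h := hs hp
    have hc : c₀ * c₀' ≤ 0 := by nlinarith
    have hz : c₀ = 0 ∧ c₀' = 0 := by
      rcases lt_trichotomy c₀ 0 with a | a | a <;> rcases lt_trichotomy c₀' 0 with b | b | b <;>
        simp only [a, b, Real.sign_of_neg, Real.sign_of_pos, Real.sign_zero] at h <;>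
        first
          | exact ⟨a, b⟩
          | (exfalso; norm_num at h; done)
          | (exfalso; nlinarith [mul_pos_of_neg_of_neg a b])
          | (exfalso; nlinarith [mul_pos a b])
    obtain ⟨rfl, rfl⟩ := hz
    have : c₁ = 0 := by nlinarith
    subst this
    have : c₁' = 0 := by nlinarith
    subst this
    exact fb_of_scale _ _ _ _ 1 1 (Or.inl rfl) one_pos (by ring) (by ring)

/-- Laurent identity: coefficients. -/
lemma laurent_coeff (a b p a' b' q : ℝ)
    (h : ∀ t : ℝ, 0 < t → (a * t + b * t⁻¹ + p) * (a' * t + b' * t⁻¹ + q) = 1) :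
    a * a' = 0 ∧ b * b' = 0 ∧ p * a' + q * a = 0 ∧ p * b' + q * b = 0 ∧
      a * b' + a' * b + p * q = 1 := by
  have h1 := h 1 (by norm_num)
  have h2 := h 2 (by norm_num)
  have h3 := h 3 (by norm_num)
  have h4 := h (1/2) (by norm_num)
  have h5 := h (1/3) (by norm_num)
  norm_num at h1 h2 h3 h4 h5
  ring_nf at h1 h2 h3 h4 h5
  refine ⟨?_, ?_, ?_, ?_, ?_⟩ <;> linarith

lemma sign_eq_of (x y : ℝ) (h1 : 0 < x → 0 < y) (h2 : x < 0 → y < 0) (h3 : x = 0 → y = 0) :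
    Real.sign x = Real.sign y := by
  rcases lt_trichotomy x 0 with a | a | a
  · rw [Real.sign_of_neg a, Real.sign_of_neg (h2 a)]
  · rw [a, h3 a]
  · rw [Real.sign_of_pos a, Real.sign_of_pos (h1 a)]

lemma inv_scale (u v u' v' a b : ℝ) (ha : 0 < a) (hb : 0 < b) (hab : a * b = 1)
    (hu : u = a * u') (hv : v = b * v') :
    u * v = u' * v' ∧ (0 ≤ u * v → Real.sign ((u + v) / 2) = Real.sign ((u' + v') / 2)) := by
  have hG : u * v = u' * v' := by rw [hu, hv]; linear_combination u' * v' * hab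
  refine ⟨hG, fun h => ?_⟩
  rw [hG] at h
  subst hu hv
  have hsame : (0 ≤ u' ∧ 0 ≤ v') ∨ (u' ≤ 0 ∧ v' ≤ 0) := by
    exact mul_nonneg_iff.1 h
  rcases hsame with ⟨x, y⟩ | ⟨x, y⟩
  · rcases x.eq_or_lt with x | x <;> rcases y.eq_or_lt with y | y
    · simp [← x, ← y]
    · have := mul_pos hb y
      rw [← x, Real.sign_of_pos (by linarith), Real.sign_of_pos (by linarith)]
    · have := mul_pos ha x
      rw [← y, Real.sign_of_pos (by linarith), Real.sign_of_pos (by linarith)]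
    · have := mul_pos ha x
      have := mul_pos hb y
      rw [Real.sign_of_pos (by linarith), Real.sign_of_pos (by linarith)]
  · rcases x.eq_or_lt with x | x <;> rcases y.eq_or_lt with y | y
    · simp [x, y]
    · have := mul_neg_of_pos_of_neg hb y
      rw [x, Real.sign_of_neg (by linarith), Real.sign_of_neg (by linarith)]
    · have := mul_neg_of_pos_of_neg ha x
      rw [y, Real.sign_of_neg (by linarith), Real.sign_of_neg (by linarith)]
    · have := mul_neg_of_pos_of_neg ha x
      have := mul_neg_of_pos_of_neg hb y
      rw [Real.sign_of_neg (by linarith), Real.sign_of_neg (by linarith)]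

lemma inv_of_fb (c₀ c₁ c₀' c₁' : ℝ)
    (hfb : FbEquiv2 (hypSys c₀ c₁) (hypSys c₀' c₁') (0 : ℝ × ℝ) (0 : ℝ × ℝ)) :
    c₀ ^ 2 - c₁ ^ 2 = c₀' ^ 2 - c₁' ^ 2 ∧
      (0 ≤ c₀ ^ 2 - c₁ ^ 2 → Real.sign c₀ = Real.sign c₀') := by
  obtain ⟨φ, ψ, U, -, hU, -, hbij, -, -, -, heq⟩ := hfb
  have hb := hbij 0 hU
  have he := heq 0 hU
  generalize fderiv ℝ φ 0 = L at hb he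
  obtain ⟨v₁, hv₁⟩ := hb.2 (1, 0)
  obtain ⟨v₂, hv₂⟩ := hb.2 (0, 1)
  have hlin : ∀ x y : ℝ, L (x • v₁ + y • v₂) = (x, y) := by
    intro x y
    rw [map_add, map_smul, map_smul, hv₁, hv₂]; simp
  have hg : ∀ w, hypSys c₀ c₁ 0 (ψ 0 w) =
      (Real.cosh w + c₀') • v₁ + (Real.sinh w + c₁') • v₂ := by
    intro w
    apply hb.1
    rw [he w, hlin]; rfl
  have hind : ∀ x y : ℝ, x • v₁ + y • v₂ = 0 → x = 0 ∧ y = 0 := by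
    intro x y h
    have := hlin x y
    rw [h, map_zero] at this
    exact ⟨(congrArg Prod.fst this).symm, (congrArg Prod.snd this).symm⟩
  obtain ⟨p₁, q₁⟩ := v₁
  obtain ⟨p₂, q₂⟩ := v₂
  have hdet : p₁ * q₂ - p₂ * q₁ ≠ 0 := by
    intro h
    have e1 := hind p₂ (-p₁) (by ext <;> simp <;> linarith)
    have e2 := hind q₂ (-q₁) (by ext <;> simp <;> linarith)
    have e3 := hind 1 0 (by
      ext
      · simp; linarith [e1.2]
      · simp; linarith [e2.2])
    exact one_ne_zero e3.1
  have hx : ∀ t : ℝ, 0 < t → ∃ s : ℝ, 0 < s ∧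
      s = (p₁ + q₁ + p₂ + q₂) / 2 * t + (p₁ + q₁ - p₂ - q₂) / 2 * t⁻¹ +
        (c₀' * (p₁ + q₁) + c₁' * (p₂ + q₂) - (c₀ + c₁)) ∧
      s⁻¹ = (p₁ - q₁ + p₂ - q₂) / 2 * t + (p₁ - q₁ - p₂ + q₂) / 2 * t⁻¹ +
        (c₀' * (p₁ - q₁) + c₁' * (p₂ - q₂) - (c₀ - c₁)) := by
    intro t ht
    have h := hg (Real.log t)
    simp only [hypSys, Prod.smul_mk, Prod.mk_add_mk, Prod.mk.injEq, smul_eq_mul,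
      Real.cosh_log ht, Real.sinh_log ht] at h
    refine ⟨Real.exp (ψ 0 (Real.log t)), Real.exp_pos _, ?_, ?_⟩
    · rw [← Real.cosh_add_sinh]; linear_combination h.1 + h.2
    · rw [← Real.exp_neg, ← Real.cosh_sub_sinh]; linear_combination h.1 - h.2
  have hd : (p₁ + q₁ + p₂ + q₂) / 2 * ((p₁ - q₁ - p₂ + q₂) / 2) -
      (p₁ + q₁ - p₂ - q₂) / 2 * ((p₁ - q₁ + p₂ - q₂) / 2) ≠ 0 := by
    intro h; apply hdet; linear_combination h
  obtain ⟨a, ha⟩ : ∃ a, a = (p₁ + q₁ + p₂ + q₂) / 2 := ⟨_, rfl⟩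
  obtain ⟨b, hb⟩ : ∃ b, b = (p₁ + q₁ - p₂ - q₂) / 2 := ⟨_, rfl⟩
  obtain ⟨a', ha'⟩ : ∃ a, a = (p₁ - q₁ + p₂ - q₂) / 2 := ⟨_, rfl⟩
  obtain ⟨b', hb'⟩ : ∃ a, a = (p₁ - q₁ - p₂ + q₂) / 2 := ⟨_, rfl⟩
  obtain ⟨P, hP⟩ : ∃ P, P = c₀' * (p₁ + q₁) + c₁' * (p₂ + q₂) - (c₀ + c₁) := ⟨_, rfl⟩
  obtain ⟨Q, hQ⟩ : ∃ P, P = c₀' * (p₁ - q₁) + c₁' * (p₂ - q₂) - (c₀ - c₁) := ⟨_, rfl⟩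
  rw [← ha, ← hb, ← ha', ← hb'] at hd
  rw [← ha, ← hb, ← ha', ← hb', ← hP, ← hQ] at hx
  have hP2 : c₀ + c₁ = a * (c₀' + c₁') + b * (c₀' - c₁') - P := by
    rw [hP, ha, hb]; ring
  have hQ2 : c₀ - c₁ = a' * (c₀' + c₁') + b' * (c₀' - c₁') - Q := by
    rw [hQ, ha', hb']; ring
  obtain ⟨k1, k2, k3, k4, k5⟩ := laurent_coeff a b P a' b' Q (by
    intro t ht
    obtain ⟨s, hs, e1, e2⟩ := hx t ht
    rw [← e1, ← e2]; exact mul_inv_cancel₀ hs.ne')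
  obtain ⟨s, hs, e1, e2⟩ := hx 1 one_pos
  have hs' := inv_pos.2 hs
  rw [e1] at hs
  rw [e2] at hs'
  rcases mul_eq_zero.1 k1 with h | h
  · subst h
    have hb0 : b ≠ 0 := by rintro rfl; simp at hd
    have ha0 : a' ≠ 0 := by rintro rfl; simp at hd
    have hb'0 : b' = 0 := by simpa [hb0] using k2
    have hP0 : P = 0 := by simpa [ha0] using k3
    have hQ0 : Q = 0 := by simpa [hb0, hb'0] using k4
    simp only [hP0, hb'0, hQ0, mul_one, inv_one, zero_mul, mul_zero, zero_add, add_zero, sub_zero] at hP2 hQ2 k5 hs hs'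
    obtain ⟨r1, r2⟩ := inv_scale (c₀ + c₁) (c₀ - c₁) (c₀' - c₁') (c₀' + c₁') b a'
      (by linarith) (by linarith) (by linarith) (by linarith) (by linarith)
    refine ⟨by linarith, fun h => ?_⟩
    have := r2 (by linarith)
    ring_nf at this
    exact this
  · subst h
    have hb0 : b' ≠ 0 := by rintro rfl; simp at hd
    have ha0 : a ≠ 0 := by rintro rfl; simp at hd
    have hb'0 : b = 0 := by simpa [hb0] using k2
    have hQ0 : Q = 0 := by simpa [ha0] using k3
    have hP0 : P = 0 := by simpa [hb0, hb'0] using k4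
    simp only [hP0, hb'0, hQ0, mul_one, inv_one, zero_mul, mul_zero, zero_add, add_zero, sub_zero] at hP2 hQ2 k5 hs hs'
    obtain ⟨r1, r2⟩ := inv_scale (c₀ + c₁) (c₀ - c₁) (c₀' + c₁') (c₀' - c₁') a b'
      (by linarith) (by linarith) (by linarith) (by linarith) (by linarith)
    refine ⟨by linarith, fun h => ?_⟩
    have := r2 (by linarith)
    ring_nf at this
    exact this

lemma sign_sq_of_ne (x : ℝ) (h : x ≠ 0) : Real.sign x ^ 2 = 1 := by
  rcases lt_or_gt_of_ne h with a | a
  · rw [Real.sign_of_neg a]; norm_num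
  · rw [Real.sign_of_pos a]; norm_num

lemma sign_sign_mul (x r : ℝ) (h : x ≠ 0) (hr : 0 < r) :
    Real.sign x = Real.sign (Real.sign x * r) := by
  rcases lt_or_gt_of_ne h with a | a
  · rw [Real.sign_of_neg a, Real.sign_of_neg (by linarith)]
  · rw [Real.sign_of_pos a, Real.sign_of_pos (by linarith)]

/-- a constant-form hyperbolic system `ż = cosh w + c₀, ẏ = sinh w + c₁`
with `Γ = c₀² − c₁²` is locally feedback equivalent at `0` to the canonical form
(a) `(cosh w + ε√Γ, sinh w)` if `Γ > 0` (`ε = sgn c₀`);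
(b) `(cosh w, sinh w + √(−Γ))` if `Γ < 0`;
(c) `(cosh w + ε, sinh w + 1)` if `Γ = 0`, `c₀ ≠ 0` (`ε = sgn c₀`);
(d) `(cosh w, sinh w)` if `c₀ = c₁ = 0`;
and `(Γ, ε)` is a complete invariant: two constant-form hyperbolic systems are locally
feedback equivalent iff they have the same `Γ` and, when `Γ ≥ 0`, the same `ε = sgn c₀`. -/
theorem stmt_17 :
    -- (a)
    (∀ c₀ c₁ : ℝ, 0 < c₀ ^ 2 - c₁ ^ 2 →
      FbEquiv2 (hypSys c₀ c₁)
        (hypSys (Real.sign c₀ * Real.sqrt (c₀ ^ 2 - c₁ ^ 2)) 0)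
        (0 : ℝ × ℝ) (0 : ℝ × ℝ)) ∧
    -- (b)
    (∀ c₀ c₁ : ℝ, c₀ ^ 2 - c₁ ^ 2 < 0 →
      FbEquiv2 (hypSys c₀ c₁)
        (hypSys 0 (Real.sqrt (-(c₀ ^ 2 - c₁ ^ 2))))
        (0 : ℝ × ℝ) (0 : ℝ × ℝ)) ∧
    -- (c)
    (∀ c₀ c₁ : ℝ, c₀ ^ 2 - c₁ ^ 2 = 0 → c₀ ≠ 0 →
      FbEquiv2 (hypSys c₀ c₁) (hypSys (Real.sign c₀) 1)
        (0 : ℝ × ℝ) (0 : ℝ × ℝ)) ∧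
    -- (d)
    (FbEquiv2 (hypSys 0 0) (hypSys 0 0) (0 : ℝ × ℝ) (0 : ℝ × ℝ)) ∧
    -- completeness of the invariant (Γ, ε)
    (∀ c₀ c₁ c₀' c₁' : ℝ,
      FbEquiv2 (hypSys c₀ c₁) (hypSys c₀' c₁') (0 : ℝ × ℝ) (0 : ℝ × ℝ) ↔
        (c₀ ^ 2 - c₁ ^ 2 = c₀' ^ 2 - c₁' ^ 2 ∧
          (0 ≤ c₀ ^ 2 - c₁ ^ 2 → Real.sign c₀ = Real.sign c₀'))) := by
  refine ⟨?_, ?_, ?_, ?_, ?_⟩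
  · intro c₀ c₁ h
    have hc : c₀ ≠ 0 := by rintro rfl; nlinarith [sq_nonneg c₁]
    apply fb_of_inv
    · rw [mul_pow, sign_sq_of_ne _ hc, Real.sq_sqrt h.le]; ring
    · intro _
      exact sign_sign_mul _ _ hc (Real.sqrt_pos.2 h)
  · intro c₀ c₁ h
    apply fb_of_inv
    · rw [Real.sq_sqrt (by linarith)]; ring
    · intro h'; linarith
  · intro c₀ c₁ h hc
    apply fb_of_inv
    · rw [sign_sq_of_ne _ hc, h]; ring
    · intro _
      simpa using sign_sign_mul c₀ 1 hc one_pos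
  · exact fb_of_inv _ _ _ _ rfl (fun _ => rfl)
  · intro c₀ c₁ c₀' c₁'
    exact ⟨inv_of_fb _ _ _ _, fun h => fb_of_inv _ _ _ _ h.1 h.2⟩
end
end
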